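/- Let K ∈ C¹(ℝ²) have a stable critical point in a bounded open set A ⊂ ℝ². Then there exists k₀>0 such that for every k>k₀ there exists ε₀>0 such that for every real ε with |ε|<ε₀ there exists an embedded Euclidean (k+εK)-loop, i.e. an embedded nonconstant C² 2π-periodic solution u : ℝ → ℝ² of u'' = L(u)(k+εK(u)) iu'. -/

import Mathlib

open Real MeasureTheory Filter Topology

noncomputable section

/-- Rotation by π/2 in the plane: `iw = (-w₂, w₁)`. -/
def rot (w : ℝ × ℝ) : ℝ × ℝ := (-w.2, w.1)

/-- Euclidean dot product in ℝ². -/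
def dotp (v w : ℝ × ℝ) : ℝ := v.1 * w.1 + v.2 * w.2

/-- The length-type functional `L(u) = ((1/2π)∫₀^{2π} |u'|² dt)^{1/2}`. -/
def eucL (u : ℝ → ℝ × ℝ) : ℝ :=
  Real.sqrt ((1 / (2 * π)) * ∫ t in (0:ℝ)..(2 * π),
    ((deriv u t).1 ^ 2 + (deriv u t).2 ^ 2))

/-- `u` is a Euclidean `K`-loop: a nonconstant C² `2π`-periodic plane curve solving
`u'' = L(u) K(u) iu'`; it then has Euclidean curvature `K(u(t))` at each point. -/
def IsELoop (K : (ℝ × ℝ) → ℝ) (u : ℝ → ℝ × ℝ) : Prop :=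
  ContDiff ℝ 2 u ∧ Function.Periodic u (2 * π) ∧
  (¬ ∃ c, ∀ t, u t = c) ∧
  ∀ t, deriv (deriv u) t = (eucL u * K (u t)) • rot (deriv u t)

/-- A `2π`-periodic curve is embedded if it is injective modulo `2π`. -/
def IsEmbedded (u : ℝ → ℝ × ℝ) : Prop :=
  ∀ t s : ℝ, u t = u s → ∃ n : ℤ, t - s = 2 * π * (n : ℝ)

/-- The Euclidean open disk of center `c` and radius `r` in `ℝ × ℝ`. -/
def EBall (c : ℝ × ℝ) (r : ℝ) : Set (ℝ × ℝ) :=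
  {p : ℝ × ℝ | (p.1 - c.1) ^ 2 + (p.2 - c.2) ^ 2 < r ^ 2}

/-- The Euclidean Melnikov function `F(z) = ∫_{D_{1/k}(z)} K(q) dq`. -/
def FmelE (k : ℝ) (K : (ℝ × ℝ) → ℝ) (z : ℝ × ℝ) : ℝ :=
  ∫ q in EBall z (1 / k), K q

/-- `X` has a stable critical point in the bounded open set `A`: some `C¹`-neighborhood of
`X` consists of functions having a critical point in `A`. -/
def HasStableCriticalPt (X : (ℝ × ℝ) → ℝ) (A : Set (ℝ × ℝ)) : Prop :=
  ∃ r > (0:ℝ), ∀ G : (ℝ × ℝ) → ℝ,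
    (∃ U : Set (ℝ × ℝ), IsOpen U ∧ closure A ⊆ U ∧ ContDiffOn ℝ 1 G U) →
    (∀ z ∈ closure A, |G z - X z| + ‖fderiv ℝ G z - fderiv ℝ X z‖ < r) →
    ∃ z ∈ A, fderiv ℝ G z = 0

lemma HasDerivAt.fst_comp {γ : ℝ → ℝ × ℝ} {v : ℝ × ℝ} {θ : ℝ} (h : HasDerivAt γ v θ) :
    HasDerivAt (fun t => (γ t).1) v.1 θ := by
  simpa using h.hasFDerivAt.fst.hasDerivAt

lemma HasDerivAt.snd_comp {γ : ℝ → ℝ × ℝ} {v : ℝ × ℝ} {θ : ℝ} (h : HasDerivAt γ v θ) :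
    HasDerivAt (fun t => (γ t).2) v.2 θ := by
  simpa using h.hasFDerivAt.snd.hasDerivAt

/-- A closed curve whose tangent direction at `θ` is `(cos θ, sin θ)` is embedded. -/
lemma isEmbedded_of_tangent {γ : ℝ → ℝ × ℝ} {ρ : ℝ → ℝ} (hpos : ∀ θ, 0 < ρ θ)
    (hγ : ∀ θ, HasDerivAt γ (ρ θ • (cos θ, sin θ)) θ)
    (hper : Function.Periodic γ (2 * π)) : IsEmbedded γ := by
  have short_arc : ∀ a b : ℝ, a < b → b - a ≤ π → γ a ≠ γ b := by
    intro a b hab hle heq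
    set m := (a + b) / 2 with hm
    have hd : ∀ θ, HasDerivAt (fun θ => cos m * (γ θ).1 + sin m * (γ θ).2)
        (ρ θ * cos (θ - m)) θ := by
      intro θ
      have h1 := (hγ θ).fst_comp.const_mul (cos m)
      have h2 := (hγ θ).snd_comp.const_mul (sin m)
      refine (h1.add h2).congr_deriv ?_
      simp only [Prod.smul_fst, Prod.smul_snd, smul_eq_mul, cos_sub]
      ring
    have hmono : StrictMonoOn (fun θ => cos m * (γ θ).1 + sin m * (γ θ).2) (Set.Icc a b) := by
      apply strictMonoOn_of_deriv_pos (convex_Icc a b)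
      · exact fun θ _ => (hd θ).continuousAt.continuousWithinAt
      · intro θ hθ
        rw [interior_Icc] at hθ
        rw [(hd θ).deriv]
        refine mul_pos (hpos θ) (cos_pos_of_mem_Ioo ⟨?_, ?_⟩) <;> linarith [hθ.1, hθ.2]
    have := hmono ⟨le_refl a, hab.le⟩ ⟨hab.le, le_refl b⟩ hab
    simp only [heq, lt_self_iff_false] at this
  intro t s hts
  have h2π : (0 : ℝ) < 2 * π := by positivity
  set n : ℤ := ⌊(t - s) / (2 * π)⌋ with hn
  set d : ℝ := t - s - n * (2 * π) with hd
  have hd0 : 0 ≤ d := by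
    have := Int.floor_le ((t - s) / (2 * π))
    rw [le_div_iff₀ h2π] at this
    linarith
  have hd1 : d < 2 * π := by
    have := Int.lt_floor_add_one ((t - s) / (2 * π))
    rw [div_lt_iff₀ h2π] at this
    linarith
  have hsd : γ (s + d) = γ s := by
    rw [← hts, show s + d = t - n * (2 * π) by rw [hd]; ring]
    exact hper.sub_int_mul_eq n
  rcases hd0.eq_or_lt with h0 | h0
  · exact ⟨n, by linarith⟩
  · exfalso
    rcases le_or_gt d π with h | h
    · exact short_arc s (s + d) (by linarith) (by linarith) hsd.symm
    · exact short_arc (s + d) (s + 2 * π) (by linarith) (by linarith)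
        (by rw [hsd, hper s])

/-- Reparametrizing by arclength a closed curve given in terms of its tangent angle yields an
embedded loop. -/
lemma exists_loop_of_tangent {κ : ℝ × ℝ → ℝ} (hκ : Continuous κ) {γ : ℝ → ℝ × ℝ}
    (hpos : ∀ θ, 0 < κ (γ θ))
    (hγ : ∀ θ, HasDerivAt γ ((κ (γ θ))⁻¹ • (cos θ, sin θ)) θ)
    (hper : Function.Periodic γ (2 * π)) :
    ∃ u : ℝ → ℝ × ℝ, IsELoop κ u ∧ IsEmbedded u := by
  have h2π : (0 : ℝ) < 2 * π := by positivity
  have hγc : Continuous γ := continuous_iff_continuousAt.2 fun θ => (hγ θ).continuousAt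
  set ρ : ℝ → ℝ := fun θ => (κ (γ θ))⁻¹ with hρ
  have hρc : Continuous ρ := (hκ.comp hγc).inv₀ fun θ => (hpos θ).ne'
  have hρpos : ∀ θ, 0 < ρ θ := fun θ => inv_pos.2 (hpos θ)
  have hρper : Function.Periodic ρ (2 * π) := fun θ => by simp only [hρ, hper θ]
  have hprim : ∀ a b, IntervalIntegrable ρ volume a b := hρc.intervalIntegrable
  set S : ℝ → ℝ := fun θ => ∫ φ in (0:ℝ)..θ, ρ φ with hS
  have hSd : ∀ θ, HasDerivAt S (ρ θ) θ := fun θ =>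
    intervalIntegral.integral_hasDerivAt_right (hprim _ _)
      (hρc.stronglyMeasurableAtFilter _ _) hρc.continuousAt
  have hSmono : StrictMono S := strictMono_of_deriv_pos fun θ => by
    rw [(hSd θ).deriv]; exact hρpos θ
  have hSc : Continuous S := continuous_iff_continuousAt.2 fun θ => (hSd θ).continuousAt
  have htop : Tendsto S atTop atTop :=
    hρper.tendsto_atTop_intervalIntegral_of_pos' (hprim _ _) hρpos h2π
  have hbot : Tendsto S atBot atBot :=
    hρper.tendsto_atBot_intervalIntegral_of_pos' (hprim _ _) hρpos h2π
  have hsurj : Function.Surjective S := hSc.surjective htop hbot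
  set e : ℝ ≃o ℝ := hSmono.orderIsoOfSurjective S hsurj with he
  have heS : ∀ θ, e θ = S θ := fun θ => rfl
  set L : ℝ := S (2 * π) / (2 * π) with hL
  have hLpos : 0 < L := div_pos
    (intervalIntegral.intervalIntegral_pos_of_pos (hprim _ _) hρpos h2π) h2π
  have hSper : ∀ θ, S (θ + 2 * π) = S θ + 2 * π * L := by
    intro θ
    have h1 : S (θ + 2 * π) = S θ + ∫ φ in θ..(θ + 2 * π), ρ φ :=
      (intervalIntegral.integral_add_adjacent_intervals (hprim _ _) (hprim _ _)).symm
    rw [h1, hρper.intervalIntegral_add_eq θ 0, zero_add, hL]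
    field_simp
    rfl
  set φ : ℝ → ℝ := fun t => e.symm (L * t) with hφ
  have hSφ : ∀ t, S (φ t) = L * t := fun t => by
    rw [← heS]; exact e.apply_symm_apply _
  have hφc : Continuous φ := e.symm.continuous.comp (continuous_const.mul continuous_id)
  have hφd : ∀ t, HasDerivAt φ (L * κ (γ (φ t))) t := by
    intro t
    have h1 : HasDerivAt (fun s => e.symm s) (ρ (φ t))⁻¹ (L * t) :=
      HasDerivAt.of_local_left_inverse e.symm.continuous.continuousAt (hSd (φ t))
        (hρpos _).ne' (Eventually.of_forall fun y => e.apply_symm_apply y)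
    have h2 : HasDerivAt (fun t : ℝ => L * t) L t := by
      simpa using (hasDerivAt_id t).const_mul L
    refine (h1.comp t h2).congr_deriv ?_
    simp only [hρ, inv_inv]
    ring
  have hφper : ∀ t, φ (t + 2 * π) = φ t + 2 * π := by
    intro t
    apply hSmono.injective
    rw [hSφ, hSper, hSφ]
    ring
  have hud : ∀ t, HasDerivAt (fun t => γ (φ t)) (L • (cos (φ t), sin (φ t))) t := by
    intro t
    refine ((hγ (φ t)).scomp t (hφd t)).congr_deriv ?_
    rw [smul_smul, mul_assoc, mul_inv_cancel₀ (hpos _).ne', mul_one]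
  have hu' : deriv (fun t => γ (φ t)) = fun t => L • (cos (φ t), sin (φ t)) :=
    funext fun t => (hud t).deriv
  have hudd : ∀ t, HasDerivAt (fun t => L • (cos (φ t), sin (φ t)))
      ((L * κ (γ (φ t))) • rot (L • (cos (φ t), sin (φ t)))) t := by
    intro t
    refine (((hφd t).cos.prodMk (hφd t).sin).const_smul L).congr_deriv ?_
    simp only [rot, Prod.smul_mk, smul_eq_mul, Prod.mk.injEq]
    constructor <;> ring
  have hu'' : deriv (fun t => L • (cos (φ t), sin (φ t))) =
      fun t => (L * κ (γ (φ t))) • rot (L • (cos (φ t), sin (φ t))) :=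
    funext fun t => (hudd t).deriv
  have hLeq : eucL (fun t => γ (φ t)) = L := by
    rw [eucL, hu']
    have : (fun t => (L • (cos (φ t), sin (φ t))).1 ^ 2 + (L • (cos (φ t), sin (φ t))).2 ^ 2)
        = fun _ => L ^ 2 := by
      funext t
      simp only [Prod.smul_mk, smul_eq_mul]
      linear_combination L ^ 2 * Real.cos_sq_add_sin_sq (φ t)
    rw [this, intervalIntegral.integral_const, smul_eq_mul, sub_zero, ← mul_assoc,
      one_div_mul_cancel h2π.ne', one_mul, Real.sqrt_sq hLpos.le]
  refine ⟨fun t => γ (φ t), ⟨?_, ?_, ?_, ?_⟩, ?_⟩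
  · rw [show (2 : WithTop ℕ∞) = 1 + 1 by norm_num, contDiff_succ_iff_deriv]
    refine ⟨fun t => (hud t).differentiableAt, by simp, ?_⟩
    rw [hu', contDiff_one_iff_deriv]
    refine ⟨fun t => (hudd t).differentiableAt, ?_⟩
    rw [hu'']
    unfold rot
    fun_prop
  · intro t
    simp only [hφper, hper (φ t)]
  · rintro ⟨c, hc⟩
    have h0 := (hud 0).unique ((hasDerivAt_const 0 c).congr_of_eventuallyEq
      (Eventually.of_forall hc))
    have h1 := congrArg Prod.fst h0
    have h2 := congrArg Prod.snd h0
    simp only [Prod.smul_mk, smul_eq_mul, Prod.fst_zero, Prod.snd_zero, mul_eq_zero,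
      hLpos.ne', false_or] at h1 h2
    have := Real.cos_sq_add_sin_sq (φ 0)
    rw [h1, h2] at this
    norm_num at this
  · intro t
    rw [hLeq, hu', hu'']
  · intro t s hts
    obtain ⟨n, hn⟩ := isEmbedded_of_tangent hρpos hγ hper (φ t) (φ s) hts
    refine ⟨n, ?_⟩
    have hSn : ∀ m : ℤ, ∀ θ, S (θ + 2 * π * m) = S θ + 2 * π * L * m := by
      have hq : Function.Periodic (fun θ => S θ - L * θ) (2 * π) := fun θ => by
        simp only [hSper]; ring
      intro m θ
      have := hq.int_mul m θ
      rw [show θ + 2 * π * m = θ + m * (2 * π) by ring]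
      linear_combination this
    have h1 := hSn n (φ s)
    rw [show φ s + 2 * π * n = φ t by linarith, hSφ, hSφ] at h1
    exact mul_left_cancel₀ hLpos.ne' (by linarith)

/-- First-order Taylor expansion of a `C¹` function, uniform on balls. -/
lemma exists_uniform_taylor {f : ℝ × ℝ → ℝ} (hf : ContDiff ℝ 1 f) (R : ℝ) {η : ℝ} (hη : 0 < η) :
    ∃ δ > 0, ∀ p ∈ Metric.closedBall (0 : ℝ × ℝ) R, ∀ v : ℝ × ℝ, ‖v‖ ≤ δ →
      |f (p + v) - f p - fderiv ℝ f p v| ≤ η * ‖v‖ := by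
  have huc : UniformContinuousOn (fderiv ℝ f) (Metric.closedBall (0 : ℝ × ℝ) (R + 1)) :=
    (isCompact_closedBall _ _).uniformContinuousOn_of_continuous
      (hf.continuous_fderiv one_ne_zero).continuousOn
  obtain ⟨δ, hδ, h⟩ := Metric.uniformContinuousOn_iff.1 huc η hη
  refine ⟨min (δ / 2) 1, by positivity, fun p hp v hv => ?_⟩
  have hv1 : ‖v‖ ≤ δ / 2 := hv.trans (min_le_left _ _)
  have hv2 : ‖v‖ ≤ 1 := hv.trans (min_le_right _ _)
  rw [mem_closedBall_zero_iff] at hp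
  have key := (convex_closedBall p ‖v‖).norm_image_sub_le_of_norm_fderiv_le' (𝕜 := ℝ) (f := f)
    (φ := fderiv ℝ f p) (C := η) (x := p) (y := p + v)
    (fun x _ => (hf.differentiable one_ne_zero) x) (fun x hx => ?_)
    (Metric.mem_closedBall_self (norm_nonneg v)) (by simp)
  · simpa using key
  · rw [Metric.mem_closedBall] at hx
    rw [← dist_eq_norm]
    refine (h x ?_ p ?_ (by linarith)).le
    · rw [mem_closedBall_zero_iff]
      have h1 := norm_le_norm_add_norm_sub' x p
      rw [← dist_eq_norm] at h1
      linarith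
    · rw [mem_closedBall_zero_iff]
      linarith

/-- A `C¹` function with bounded differential has a `C¹` primitive in the first variable. -/
lemma exists_primitive_fst {κ : ℝ × ℝ → ℝ} (hκ : ContDiff ℝ 1 κ) {M : ℝ}
    (hM : ∀ p, ‖fderiv ℝ κ p‖ ≤ M) :
    ∃ Q : ℝ × ℝ → ℝ, ContDiff ℝ 1 Q ∧ ∀ p, fderiv ℝ Q p (1, 0) = κ p := by
  have hκc : Continuous κ := hκ.continuous
  have hdκ : Continuous (fderiv ℝ κ) := hκ.continuous_fderiv one_ne_zero
  set Λ : ℝ → ℝ × ℝ →L[ℝ] ℝ × ℝ := fun s =>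
    (s • ContinuousLinearMap.fst ℝ ℝ ℝ).prod (ContinuousLinearMap.snd ℝ ℝ ℝ) with hΛ
  have hΛc : Continuous Λ := by
    have : Λ = fun s => s • ((ContinuousLinearMap.fst ℝ ℝ ℝ).prod
        (0 : ℝ × ℝ →L[ℝ] ℝ)) + (0 : ℝ × ℝ →L[ℝ] ℝ).prod (ContinuousLinearMap.snd ℝ ℝ ℝ) := by
      funext s
      ext <;> simp [hΛ]
    rw [this]
    fun_prop
  have hΛa : ∀ s p, Λ s p = (s * p.1, p.2) := fun s p => rfl
  have hΛp : Continuous fun q : (ℝ × ℝ) × ℝ => Λ q.2 q.1 := by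
    simp only [hΛa]
    fun_prop
  have hd : ∀ s p, HasFDerivAt (fun p => κ (Λ s p)) ((fderiv ℝ κ (Λ s p)).comp (Λ s)) p :=
    fun s p => ((hκ.differentiable one_ne_zero) _).hasFDerivAt.comp p (Λ s).hasFDerivAt
  have hF'c : Continuous fun q : (ℝ × ℝ) × ℝ => (fderiv ℝ κ (Λ q.2 q.1)).comp (Λ q.2) :=
    (hdκ.comp hΛp).clm_comp (hΛc.comp continuous_snd)
  have hΛn : ∀ s ∈ Set.uIoc (0 : ℝ) 1, ‖Λ s‖ ≤ 1 := by
    intro s hs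
    rw [Set.uIoc_of_le zero_le_one] at hs
    refine ContinuousLinearMap.opNorm_le_bound _ zero_le_one fun p => ?_
    rw [hΛa, one_mul, Prod.norm_def, Prod.norm_def]
    refine max_le_max ?_ le_rfl
    rw [norm_mul, Real.norm_of_nonneg hs.1.le]
    exact mul_le_of_le_one_left (norm_nonneg _) hs.2
  have hI : ∀ p, HasFDerivAt (fun p => ∫ s in (0:ℝ)..1, κ (Λ s p))
      (∫ s in (0:ℝ)..1, (fderiv ℝ κ (Λ s p)).comp (Λ s)) p := by
    intro p
    refine intervalIntegral.hasFDerivAt_integral_of_dominated_of_fderiv_le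
      (F' := fun p s => (fderiv ℝ κ (Λ s p)).comp (Λ s)) (bound := fun _ => M)
      (s := Set.univ) Filter.univ_mem ?_ ?_ ?_ ?_ ?_ ?_
    · exact Eventually.of_forall fun x =>
        (hκc.comp (hΛp.comp (by fun_prop : Continuous fun s : ℝ => (x, s)))).aestronglyMeasurable
    · exact (hκc.comp (hΛp.comp
        (by fun_prop : Continuous fun s : ℝ => (p, s)))).intervalIntegrable _ _
    · exact (hF'c.comp (by fun_prop : Continuous fun s : ℝ => (p, s))).aestronglyMeasurable
    · refine Eventually.of_forall fun s hs x _ => ?_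
      refine (ContinuousLinearMap.opNorm_comp_le _ _).trans ?_
      have h0 : (0 : ℝ) ≤ M := (norm_nonneg _).trans (hM 0)
      calc _ ≤ M * 1 := mul_le_mul (hM _) (hΛn s hs) (norm_nonneg _) h0
        _ = M := mul_one M
    · exact intervalIntegrable_const
    · exact Eventually.of_forall fun s _ x _ => hd s x
  have hIc : Continuous fun p => ∫ s in (0:ℝ)..1, (fderiv ℝ κ (Λ s p)).comp (Λ s) :=
    intervalIntegral.continuous_parametric_intervalIntegral_of_continuous'
      (f := fun p s => (fderiv ℝ κ (Λ s p)).comp (Λ s)) hF'c 0 1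
  have hI1 : ContDiff ℝ 1 (fun p => ∫ s in (0:ℝ)..1, κ (Λ s p)) :=
    contDiff_one_iff_hasFDerivAt.2 ⟨_, hIc, hI⟩
  have hQ : ContDiff ℝ 1 (fun p : ℝ × ℝ => p.1 * ∫ s in (0:ℝ)..1, κ (Λ s p)) :=
    contDiff_fst.mul hI1
  refine ⟨_, hQ, fun p => ?_⟩
  have hline : HasDerivAt (fun x : ℝ => (x, p.2)) ((1 : ℝ), (0 : ℝ)) p.1 :=
    (hasDerivAt_id p.1).prodMk (hasDerivAt_const _ _)
  have h1 := ((hQ.differentiable one_ne_zero) p).hasFDerivAt.comp_hasDerivAt p.1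
    (f := fun x : ℝ => (x, p.2)) hline
  have h2 : ((fun p : ℝ × ℝ => p.1 * ∫ s in (0:ℝ)..1, κ (Λ s p)) ∘ fun x : ℝ => (x, p.2)) =
      fun x => ∫ s in (0:ℝ)..x, κ (s, p.2) := by
    funext x
    simp only [Function.comp, hΛa]
    rw [intervalIntegral.mul_integral_comp_mul_right (f := fun s => κ (s, p.2))]
    simp
  rw [h2] at h1
  have hc : Continuous fun s => κ (s, p.2) := by fun_prop
  exact h1.unique (intervalIntegral.integral_hasDerivAt_right (hc.intervalIntegrable _ _)
      (hc.stronglyMeasurableAtFilter _ _) hc.continuousAt)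

/-- The primitive of `f` whose mean over `[0, 2π]` vanishes. -/
def meanZeroPrim (f : ℝ → ℝ) (θ : ℝ) : ℝ :=
  (∫ φ in (0:ℝ)..θ, f φ) - (2 * π)⁻¹ * ∫ ψ in (0:ℝ)..(2 * π), ∫ φ in (0:ℝ)..ψ, f φ

lemma hasDerivAt_integral_zero {f : ℝ → ℝ} (hf : Continuous f) (θ : ℝ) :
    HasDerivAt (fun θ => ∫ φ in (0:ℝ)..θ, f φ) (f θ) θ :=
  intervalIntegral.integral_hasDerivAt_right (hf.intervalIntegrable _ _)
    (hf.stronglyMeasurableAtFilter _ _) hf.continuousAt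

lemma continuous_integral_zero {f : ℝ → ℝ} (hf : Continuous f) :
    Continuous (fun θ => ∫ φ in (0:ℝ)..θ, f φ) :=
  continuous_iff_continuousAt.2 fun θ => (hasDerivAt_integral_zero hf θ).continuousAt

lemma hasDerivAt_meanZeroPrim {f : ℝ → ℝ} (hf : Continuous f) (θ : ℝ) :
    HasDerivAt (meanZeroPrim f) (f θ) θ :=
  (hasDerivAt_integral_zero hf θ).sub_const _

lemma continuous_meanZeroPrim {f : ℝ → ℝ} (hf : Continuous f) : Continuous (meanZeroPrim f) :=
  continuous_iff_continuousAt.2 fun θ => (hasDerivAt_meanZeroPrim hf θ).continuousAt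

lemma integral_meanZeroPrim {f : ℝ → ℝ} (hf : Continuous f) :
    ∫ θ in (0:ℝ)..(2 * π), meanZeroPrim f θ = 0 := by
  unfold meanZeroPrim
  rw [intervalIntegral.integral_sub ((continuous_integral_zero hf).intervalIntegrable _ _)
    intervalIntegrable_const, intervalIntegral.integral_const, smul_eq_mul, sub_zero,
    ← mul_assoc, mul_inv_cancel₀ (by positivity), one_mul, sub_self]

lemma meanZeroPrim_periodic {f : ℝ → ℝ} (hf : Continuous f)
    (hper : Function.Periodic f (2 * π)) (h0 : ∫ θ in (0:ℝ)..(2 * π), f θ = 0) :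
    Function.Periodic (meanZeroPrim f) (2 * π) := by
  intro θ
  have h1 := intervalIntegral.integral_add_adjacent_intervals
    (hf.intervalIntegrable (μ := volume) 0 θ) (hf.intervalIntegrable θ (θ + 2 * π))
  rw [hper.intervalIntegral_add_eq θ 0, zero_add, h0, add_zero] at h1
  simp only [meanZeroPrim, h1]

lemma meanZeroPrim_sub {f g : ℝ → ℝ} (hf : Continuous f) (hg : Continuous g) (θ : ℝ) :
    meanZeroPrim f θ - meanZeroPrim g θ = meanZeroPrim (fun θ => f θ - g θ) θ := by
  unfold meanZeroPrim
  have h1 : ∀ ψ, ∫ φ in (0:ℝ)..ψ, (f φ - g φ) =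
      (∫ φ in (0:ℝ)..ψ, f φ) - ∫ φ in (0:ℝ)..ψ, g φ := fun ψ =>
    intervalIntegral.integral_sub (hf.intervalIntegrable _ _) (hg.intervalIntegrable _ _)
  simp only [h1]
  rw [intervalIntegral.integral_sub ((continuous_integral_zero hf).intervalIntegrable _ _)
    ((continuous_integral_zero hg).intervalIntegrable _ _)]
  ring

lemma abs_integral_le_of_abs_le {f : ℝ → ℝ} {D a b : ℝ} (h : ∀ θ, |f θ| ≤ D) :
    |∫ θ in a..b, f θ| ≤ D * |b - a| := by
  rw [← Real.norm_eq_abs]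
  exact intervalIntegral.norm_integral_le_of_norm_le_const fun θ _ => h θ

lemma abs_meanZeroPrim_le {f : ℝ → ℝ} (hf : Continuous f)
    (hper : Function.Periodic f (2 * π)) (h0 : ∫ θ in (0:ℝ)..(2 * π), f θ = 0)
    {D : ℝ} (hD : ∀ θ, |f θ| ≤ D) (θ : ℝ) : |meanZeroPrim f θ| ≤ 4 * π * D := by
  have h2π : (0 : ℝ) < 2 * π := by positivity
  have hD0 : 0 ≤ D := (abs_nonneg _).trans (hD 0)
  have hprim : ∀ ψ ∈ Set.Icc 0 (2 * π), |∫ φ in (0:ℝ)..ψ, f φ| ≤ D * (2 * π) := by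
    intro ψ hψ
    refine (abs_integral_le_of_abs_le hD).trans ?_
    rw [sub_zero, abs_of_nonneg hψ.1]
    exact mul_le_mul_of_nonneg_left hψ.2 hD0
  obtain ⟨ψ, hψ, he⟩ := (meanZeroPrim_periodic hf hper h0).exists_mem_Ico₀ h2π θ
  rw [he, meanZeroPrim]
  have h1 := hprim ψ ⟨hψ.1, hψ.2.le⟩
  have h2 : |∫ ψ in (0:ℝ)..(2 * π), ∫ φ in (0:ℝ)..ψ, f φ| ≤ D * (2 * π) * |2 * π - 0| := by
    rw [← Real.norm_eq_abs]
    refine intervalIntegral.norm_integral_le_of_norm_le_const fun x hx => ?_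
    rw [Set.uIoc_of_le h2π.le] at hx
    exact hprim x ⟨hx.1.le, hx.2⟩
  rw [sub_zero, abs_of_pos h2π] at h2
  have h3 : |(2 * π)⁻¹ * ∫ ψ in (0:ℝ)..(2 * π), ∫ φ in (0:ℝ)..ψ, f φ| ≤ D * (2 * π) := by
    rw [abs_mul, abs_of_pos (inv_pos.2 h2π), inv_mul_le_iff₀ h2π]
    linarith
  calc _ ≤ _ := abs_sub _ _
    _ ≤ _ := add_le_add h1 h3
    _ = _ := by ring

/-- The mean of `τ` with respect to the weight `ρ`. -/
def weightedMean (ρ τ : ℝ → ℝ) : ℝ :=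
  (∫ θ in (0:ℝ)..(2 * π), ρ θ * τ θ) / ∫ θ in (0:ℝ)..(2 * π), ρ θ

/-- The velocity `ρ (τ - c)`, with `c` chosen so that it has zero mean. -/
def centeredSpeed (ρ τ : ℝ → ℝ) (θ : ℝ) : ℝ := ρ θ * (τ θ - weightedMean ρ τ)

/-- Radius of curvature functions with values in `[1/(2k), 2/k]`. -/
structure IsAdmissible (k : ℝ) (ρ : ℝ → ℝ) : Prop where
  cont : Continuous ρ
  per : Function.Periodic ρ (2 * π)
  lower : ∀ θ, 1 / (2 * k) ≤ ρ θ
  upper : ∀ θ, ρ θ ≤ 2 / k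

/-- A continuous `2π`-periodic function with values in `[-1, 1]`, such as `cos` or `sin`. -/
structure IsDirection (τ : ℝ → ℝ) : Prop where
  cont : Continuous τ
  per : Function.Periodic τ (2 * π)
  le_one : ∀ θ, |τ θ| ≤ 1

lemma isDirection_cos : IsDirection cos := ⟨continuous_cos, cos_periodic, abs_cos_le_one⟩

lemma isDirection_sin : IsDirection sin := ⟨continuous_sin, sin_periodic, abs_sin_le_one⟩

section Estimates

variable {k : ℝ} {ρ ρ' τ : ℝ → ℝ}

lemma continuous_centeredSpeed (hρ : Continuous ρ) (hτ : IsDirection τ) :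
    Continuous (centeredSpeed ρ τ) :=
  hρ.mul (hτ.cont.sub continuous_const)

lemma IsAdmissible.pos (hk : 0 < k) (hρ : IsAdmissible k ρ) (θ : ℝ) : 0 < ρ θ :=
  lt_of_lt_of_le (by positivity) (hρ.lower θ)

lemma IsAdmissible.continuous_mul (hρ : IsAdmissible k ρ) (hτ : Continuous τ) :
    Continuous fun θ => ρ θ * τ θ :=
  hρ.cont.mul hτ

lemma IsAdmissible.integral_lower (hρ : IsAdmissible k ρ) :
    2 * π * (1 / (2 * k)) ≤ ∫ θ in (0:ℝ)..(2 * π), ρ θ := by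
  have h2π : (0 : ℝ) ≤ 2 * π := by positivity
  have := intervalIntegral.integral_mono_on (μ := volume) h2π
    (intervalIntegrable_const (c := 1 / (2 * k)))
    (hρ.cont.intervalIntegrable _ _) (fun θ _ => hρ.lower θ)
  rwa [intervalIntegral.integral_const, smul_eq_mul, sub_zero] at this

lemma IsAdmissible.integral_pos (hk : 0 < k) (hρ : IsAdmissible k ρ) :
    0 < ∫ θ in (0:ℝ)..(2 * π), ρ θ :=
  lt_of_lt_of_le (by positivity) hρ.integral_lower

lemma abs_weightedMean_le_one (hk : 0 < k) (hρ : IsAdmissible k ρ) (hτ : IsDirection τ) :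
    |weightedMean ρ τ| ≤ 1 := by
  have h2π : (0 : ℝ) ≤ 2 * π := by positivity
  rw [weightedMean, abs_div, abs_of_pos (hρ.integral_pos hk), div_le_one (hρ.integral_pos hk)]
  refine (intervalIntegral.abs_integral_le_integral_abs h2π).trans ?_
  refine intervalIntegral.integral_mono_on h2π
    ((hρ.cont.mul hτ.cont).abs.intervalIntegrable _ _) (hρ.cont.intervalIntegrable _ _)
    (fun θ _ => ?_)
  rw [abs_mul, abs_of_pos (hρ.pos hk θ)]
  exact mul_le_of_le_one_right (hρ.pos hk θ).le (hτ.le_one θ)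

lemma integral_centeredSpeed (hk : 0 < k) (hρ : IsAdmissible k ρ) (hτ : IsDirection τ) :
    ∫ θ in (0:ℝ)..(2 * π), centeredSpeed ρ τ θ = 0 := by
  simp only [centeredSpeed, mul_sub]
  rw [intervalIntegral.integral_sub ((hρ.continuous_mul hτ.cont).intervalIntegrable _ _)
    ((hρ.continuous_mul continuous_const).intervalIntegrable _ _), intervalIntegral.integral_mul_const,
    weightedMean, mul_div_cancel₀ _ (hρ.integral_pos hk).ne', sub_self]

lemma centeredSpeed_periodic (hρ : IsAdmissible k ρ) (hτ : IsDirection τ) :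
    Function.Periodic (centeredSpeed ρ τ) (2 * π) := fun θ => by
  simp only [centeredSpeed, hρ.per θ, hτ.per θ]

lemma abs_weightedMean_sub_le (hk : 0 < k) (hρ : IsAdmissible k ρ) (hρ' : IsAdmissible k ρ')
    (hτ : IsDirection τ) {d : ℝ} (hd : ∀ θ, |ρ θ - ρ' θ| ≤ d) :
    |weightedMean ρ τ - weightedMean ρ' τ| ≤ 4 * k * d := by
  have h2π : (0 : ℝ) < 2 * π := by positivity
  have hd0 : 0 ≤ d := (abs_nonneg _).trans (hd 0)
  have hb := hρ.integral_pos hk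
  have hb' := hρ'.integral_pos hk
  have hbl := hρ.integral_lower
  have hw := abs_weightedMean_le_one hk hρ' hτ
  have e1 : |(∫ θ in (0:ℝ)..(2 * π), ρ θ * τ θ) - ∫ θ in (0:ℝ)..(2 * π), ρ' θ * τ θ|
      ≤ d * (2 * π) := by
    rw [← intervalIntegral.integral_sub ((hρ.continuous_mul hτ.cont).intervalIntegrable _ _)
      ((hρ'.continuous_mul hτ.cont).intervalIntegrable _ _)]
    refine (abs_integral_le_of_abs_le (D := d) fun θ => ?_).trans
      (by rw [sub_zero, abs_of_pos h2π])
    rw [← sub_mul, abs_mul]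
    exact (mul_le_of_le_one_right (abs_nonneg _) (hτ.le_one θ)).trans (hd θ)
  have e2 : |(∫ θ in (0:ℝ)..(2 * π), ρ' θ) - ∫ θ in (0:ℝ)..(2 * π), ρ θ| ≤ d * (2 * π) := by
    rw [← intervalIntegral.integral_sub (hρ'.cont.intervalIntegrable _ _)
      (hρ.cont.intervalIntegrable _ _)]
    refine (abs_integral_le_of_abs_le (D := d) fun θ => ?_).trans
      (by rw [sub_zero, abs_of_pos h2π])
    rw [abs_sub_comm]
    exact hd θ
  have hw' : weightedMean ρ' τ * (∫ θ in (0:ℝ)..(2 * π), ρ' θ) =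
      ∫ θ in (0:ℝ)..(2 * π), ρ' θ * τ θ := div_mul_cancel₀ _ hb'.ne'
  have hw1 : weightedMean ρ τ * (∫ θ in (0:ℝ)..(2 * π), ρ θ) =
      ∫ θ in (0:ℝ)..(2 * π), ρ θ * τ θ := div_mul_cancel₀ _ hb.ne'
  rw [← hw', ← hw1] at e1
  generalize weightedMean ρ τ = w at *
  generalize weightedMean ρ' τ = w' at *
  generalize (∫ θ in (0:ℝ)..(2 * π), ρ θ) = b at *
  generalize (∫ θ in (0:ℝ)..(2 * π), ρ' θ) = b' at *
  have key : |w - w'| * b ≤ 2 * (d * (2 * π)) := by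
    calc |w - w'| * b = |(w - w') * b| := by rw [abs_mul, abs_of_pos hb]
      _ = |(w * b - w' * b') + w' * (b' - b)| := by ring_nf
      _ ≤ |w * b - w' * b'| + |w'| * |b' - b| := by
        rw [← abs_mul]; exact abs_add_le _ _
      _ ≤ d * (2 * π) + 1 * (d * (2 * π)) := by gcongr
      _ = _ := by ring
  have key2 : |w - w'| * (2 * π * (1 / (2 * k))) ≤ 2 * (d * (2 * π)) :=
    (mul_le_mul_of_nonneg_left hbl (abs_nonneg _)).trans key
  have e3 : |w - w'| * (2 * π * (1 / (2 * k))) = |w - w'| * (2 * π) / (2 * k) := by ring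
  rw [e3, div_le_iff₀ (by positivity)] at key2
  refine le_of_mul_le_mul_right ?_ h2π
  linarith

lemma abs_centeredSpeed_sub_le (hk : 0 < k) (hρ : IsAdmissible k ρ) (hρ' : IsAdmissible k ρ')
    (hτ : IsDirection τ) {d : ℝ} (hd : ∀ θ, |ρ θ - ρ' θ| ≤ d) (θ : ℝ) :
    |centeredSpeed ρ τ θ - centeredSpeed ρ' τ θ| ≤ 10 * d := by
  have hd0 : 0 ≤ d := (abs_nonneg _).trans (hd 0)
  have h1 := abs_weightedMean_sub_le hk hρ hρ' hτ hd
  have h2 := abs_weightedMean_le_one hk hρ hτ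
  rw [abs_sub_comm] at h1
  have h3 : |τ θ - weightedMean ρ τ| ≤ 2 := (abs_sub _ _).trans (by linarith [hτ.le_one θ])
  calc |centeredSpeed ρ τ θ - centeredSpeed ρ' τ θ|
      = |(ρ θ - ρ' θ) * (τ θ - weightedMean ρ τ)
          + ρ' θ * (weightedMean ρ' τ - weightedMean ρ τ)| := by
        unfold centeredSpeed; ring_nf
    _ ≤ |ρ θ - ρ' θ| * |τ θ - weightedMean ρ τ|
          + |ρ' θ| * |weightedMean ρ' τ - weightedMean ρ τ| := by
        rw [← abs_mul, ← abs_mul]; exact abs_add_le _ _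
    _ ≤ d * 2 + (2 / k) * (4 * k * d) := by
        rw [abs_of_pos (hρ'.pos hk θ)]
        exact add_le_add (mul_le_mul (hd θ) h3 (abs_nonneg _) hd0)
          (mul_le_mul (hρ'.upper θ) h1 (abs_nonneg _) (by positivity))
    _ = 10 * d := by field_simp; ring

lemma abs_meanZeroPrim_centeredSpeed_sub_le (hk : 0 < k) (hρ : IsAdmissible k ρ)
    (hρ' : IsAdmissible k ρ') (hτ : IsDirection τ) {d : ℝ} (hd : ∀ θ, |ρ θ - ρ' θ| ≤ d) (θ : ℝ) :
    |meanZeroPrim (centeredSpeed ρ τ) θ - meanZeroPrim (centeredSpeed ρ' τ) θ| ≤ 160 * d := by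
  have hd0 : 0 ≤ d := (abs_nonneg _).trans (hd 0)
  have c1 := continuous_centeredSpeed hρ.cont hτ
  have c2 := continuous_centeredSpeed hρ'.cont hτ
  rw [meanZeroPrim_sub c1 c2]
  refine (abs_meanZeroPrim_le (c1.sub c2)
    ((centeredSpeed_periodic hρ hτ).sub (centeredSpeed_periodic hρ' hτ)) ?_
    (abs_centeredSpeed_sub_le hk hρ hρ' hτ hd) θ).trans ?_
  · simp only [Pi.sub_apply]
    rw [intervalIntegral.integral_sub (c1.intervalIntegrable _ _) (c2.intervalIntegrable _ _),
      integral_centeredSpeed hk hρ hτ, integral_centeredSpeed hk hρ' hτ, sub_zero]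
  · nlinarith [Real.pi_le_four, mul_le_mul_of_nonneg_right Real.pi_le_four hd0]

end Estimates

/-- The closed curve with mean `z` and velocity `ρ ((cos, sin) - c)`. -/
def curveOf (z : ℝ × ℝ) (ρ : ℝ → ℝ) (θ : ℝ) : ℝ × ℝ :=
  (z.1 + meanZeroPrim (centeredSpeed ρ cos) θ, z.2 + meanZeroPrim (centeredSpeed ρ sin) θ)

lemma continuous_curveOf (z : ℝ × ℝ) {ρ : ℝ → ℝ} (hρ : Continuous ρ) :
    Continuous (curveOf z ρ) :=
  (continuous_const.add (continuous_meanZeroPrim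
    (continuous_centeredSpeed hρ isDirection_cos))).prodMk
    (continuous_const.add (continuous_meanZeroPrim (continuous_centeredSpeed hρ isDirection_sin)))

lemma curveOf_periodic (z : ℝ × ℝ) {k : ℝ} (hk : 0 < k) {ρ : ℝ → ℝ} (hρ : IsAdmissible k ρ) :
    Function.Periodic (curveOf z ρ) (2 * π) := by
  intro θ
  have h1 := meanZeroPrim_periodic (continuous_centeredSpeed hρ.cont isDirection_cos)
    (centeredSpeed_periodic hρ isDirection_cos) (integral_centeredSpeed hk hρ isDirection_cos) θ
  have h2 := meanZeroPrim_periodic (continuous_centeredSpeed hρ.cont isDirection_sin)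
    (centeredSpeed_periodic hρ isDirection_sin) (integral_centeredSpeed hk hρ isDirection_sin) θ
  simp only [curveOf, h1, h2]

lemma norm_curveOf_sub_le (z z' : ℝ × ℝ) {k : ℝ} (hk : 0 < k) {ρ ρ' : ℝ → ℝ}
    (hρ : IsAdmissible k ρ) (hρ' : IsAdmissible k ρ') {d : ℝ} (hd : ∀ θ, |ρ θ - ρ' θ| ≤ d)
    (θ : ℝ) : ‖curveOf z ρ θ - curveOf z' ρ' θ‖ ≤ ‖z - z'‖ + 160 * d := by
  have h1 := abs_meanZeroPrim_centeredSpeed_sub_le hk hρ hρ' isDirection_cos hd θ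
  have h2 := abs_meanZeroPrim_centeredSpeed_sub_le hk hρ hρ' isDirection_sin hd θ
  have n1 : |z.1 - z'.1| ≤ ‖z - z'‖ := norm_fst_le (z - z')
  have n2 : |z.2 - z'.2| ≤ ‖z - z'‖ := norm_snd_le (z - z')
  rw [Prod.norm_def]
  refine max_le ?_ ?_
  · simp only [curveOf, Prod.fst_sub, Real.norm_eq_abs]
    rw [add_sub_add_comm]
    exact (abs_add_le _ _).trans (add_le_add n1 h1)
  · simp only [curveOf, Prod.snd_sub, Real.norm_eq_abs]
    rw [add_sub_add_comm]
    exact (abs_add_le _ _).trans (add_le_add n2 h2)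

lemma isAdmissible_const {k : ℝ} (hk : 0 < k) : IsAdmissible k (fun _ => 1 / k) where
  cont := continuous_const
  per := fun _ => rfl
  lower := fun _ => one_div_le_one_div_of_le hk (by linarith)
  upper := fun _ => by gcongr; norm_num

lemma centeredSpeed_const_cos {k : ℝ} :
    centeredSpeed (fun _ => 1 / k) cos = fun θ => cos θ / k := by
  funext θ
  have : weightedMean (fun _ => 1 / k) cos = 0 := by
    rw [weightedMean, intervalIntegral.integral_const_mul]
    simp
  rw [centeredSpeed, this]
  ring

lemma centeredSpeed_const_sin {k : ℝ} :
    centeredSpeed (fun _ => 1 / k) sin = fun θ => sin θ / k := by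
  funext θ
  have : weightedMean (fun _ => 1 / k) sin = 0 := by
    rw [weightedMean, intervalIntegral.integral_const_mul]
    simp
  rw [centeredSpeed, this]
  ring

lemma curveOf_const (z : ℝ × ℝ) (k θ : ℝ) :
    curveOf z (fun _ => 1 / k) θ = (z.1 + sin θ / k, z.2 - cos θ / k) := by
  have hπ : (π : ℝ) ≠ 0 := Real.pi_ne_zero
  rw [curveOf, centeredSpeed_const_cos, centeredSpeed_const_sin]
  simp only [meanZeroPrim, intervalIntegral.integral_div, integral_cos, integral_sin,
    intervalIntegral.integral_sub intervalIntegrable_const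
      (continuous_cos.intervalIntegrable _ _), intervalIntegral.integral_const, smul_eq_mul]
  simp only [sin_zero, cos_zero, sin_two_pi]
  ext
  · simp
  · simp
    field_simp
    ring

lemma abs_inv_sub_inv_le {k a b : ℝ} (hk : 0 < k) (ha : k / 2 ≤ a) (hb : k / 2 ≤ b) :
    |a⁻¹ - b⁻¹| ≤ 4 / k ^ 2 * |a - b| := by
  have ha0 : 0 < a := by linarith
  have hb0 : 0 < b := by linarith
  have hab : k ^ 2 / 4 ≤ a * b := by nlinarith
  rw [inv_sub_inv ha0.ne' hb0.ne', abs_div, abs_sub_comm b a, abs_of_pos (mul_pos ha0 hb0),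
    div_le_iff₀ (mul_pos ha0 hb0)]
  have : 1 ≤ 4 / k ^ 2 * (a * b) := by
    rw [div_mul_eq_mul_div, le_div_iff₀ (by positivity)]
    linarith
  nlinarith [abs_nonneg (a - b)]

section FixedPoint

variable {K : ℝ × ℝ → ℝ} {B ℓ k ε : ℝ}

lemma curvature_bounds (hB : ∀ p, |K p| ≤ B) (hεB : |ε| * B ≤ k / 2) (p : ℝ × ℝ) :
    k / 2 ≤ k + ε * K p ∧ k + ε * K p ≤ 2 * k := by
  have h : |ε * K p| ≤ k / 2 := by
    rw [abs_mul]
    exact (mul_le_mul_of_nonneg_left (hB p) (abs_nonneg ε)).trans hεB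
  have h0 := (abs_nonneg _).trans h
  rw [abs_le] at h
  constructor <;> linarith

lemma abs_inv_curvature_sub_le (hk : 0 < k) (hB : ∀ p, |K p| ≤ B)
    (hℓ : ∀ p q, |K p - K q| ≤ ℓ * ‖p - q‖) (hεB : |ε| * B ≤ k / 2) (p q : ℝ × ℝ) :
    |(k + ε * K p)⁻¹ - (k + ε * K q)⁻¹| ≤ |ε| * (4 / k ^ 2 * ℓ) * ‖p - q‖ := by
  refine (abs_inv_sub_inv_le hk (curvature_bounds hB hεB p).1
    (curvature_bounds hB hεB q).1).trans ?_
  rw [show k + ε * K p - (k + ε * K q) = ε * (K p - K q) by ring, abs_mul]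
  calc 4 / k ^ 2 * (|ε| * |K p - K q|) ≤ 4 / k ^ 2 * (|ε| * (ℓ * ‖p - q‖)) := by
        gcongr; exact hℓ p q
    _ = _ := by ring

/-- The radius of curvature prescribed by `k + ε K` along a continuous curve with values in a
region where `k + ε K` is between `k / 2` and `2 k`. -/
lemma isAdmissible_inv_curvature (hk : 0 < k) (hK : Continuous K) (hB : ∀ p, |K p| ≤ B)
    (hεB : |ε| * B ≤ k / 2) {γ : ℝ → ℝ × ℝ} (hγ : Continuous γ)
    (hper : Function.Periodic γ (2 * π)) : IsAdmissible k (fun θ => (k + ε * K (γ θ))⁻¹) where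
  cont := (by fun_prop : Continuous fun θ => k + ε * K (γ θ)).inv₀
    fun θ => (by linarith [(curvature_bounds hB hεB (γ θ)).1] : 0 < k + ε * K (γ θ)).ne'
  per := fun θ => by simp only [hper θ]
  lower := fun θ => by
    have h := curvature_bounds hB hεB (γ θ)
    rw [one_div]
    exact inv_anti₀ (by linarith) h.2
  upper := fun θ => by
    have h := curvature_bounds hB hεB (γ θ)
    rw [show 2 / k = (k / 2)⁻¹ by rw [inv_div]]
    exact inv_anti₀ (by linarith) h.1

/-- For small `ε` there is a closed curve with mean `z` whose radius of curvature solves the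
prescribed equation up to a constant vector. -/
lemma exists_radius (hk : 0 < k) (hK : Continuous K) (hB : ∀ p, |K p| ≤ B)
    (hℓ : ∀ p q, |K p - K q| ≤ ℓ * ‖p - q‖) (hℓ0 : 0 ≤ ℓ) (hεB : |ε| * B ≤ k / 2)
    (hεℓ : |ε| * (4 / k ^ 2 * ℓ) * 160 ≤ 1 / 2) (z : ℝ × ℝ) :
    ∃ ρ : BoundedContinuousFunction ℝ ℝ, IsAdmissible k ρ ∧
      ∀ θ, ρ θ = (k + ε * K (curveOf z ρ θ))⁻¹ := by
  set s : Set (BoundedContinuousFunction ℝ ℝ) := {ρ | IsAdmissible k ρ} with hs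
  have hclosed : IsClosed s := by
    have : s = (⋂ θ, {ρ | ρ (θ + 2 * π) = ρ θ}) ∩ ((⋂ θ, {ρ | 1 / (2 * k) ≤ ρ θ}) ∩
        ⋂ θ, {ρ | ρ θ ≤ 2 / k}) := by
      ext ρ
      simp only [hs, Set.mem_ofPred_eq, Set.mem_inter_iff, Set.mem_iInter]
      exact ⟨fun h => ⟨h.per, h.lower, h.upper⟩, fun h => ⟨ρ.continuous, h.1, h.2.1, h.2.2⟩⟩
    rw [this]
    refine (isClosed_iInter fun θ => isClosed_eq ?_ ?_).inter
      ((isClosed_iInter fun θ => isClosed_le ?_ ?_).inter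
      (isClosed_iInter fun θ => isClosed_le ?_ ?_)) <;> fun_prop
  have hcont : ∀ ρ : BoundedContinuousFunction ℝ ℝ,
      Continuous fun θ => (k + ε * K (curveOf z ρ θ))⁻¹ := by
    intro ρ
    have := continuous_curveOf z ρ.continuous
    exact (by fun_prop : Continuous fun θ => k + ε * K (curveOf z ρ θ)).inv₀ fun θ =>
      (by linarith [(curvature_bounds hB hεB (curveOf z ρ θ)).1] :
        0 < k + ε * K (curveOf z ρ θ)).ne'
  set N : BoundedContinuousFunction ℝ ℝ → BoundedContinuousFunction ℝ ℝ := fun ρ =>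
    BoundedContinuousFunction.ofNormedAddCommGroup _ (hcont ρ) (2 / k) (fun θ => by
      have h := curvature_bounds hB hεB (curveOf z ρ θ)
      rw [Real.norm_of_nonneg (inv_nonneg.2 (by linarith)),
        show 2 / k = (k / 2)⁻¹ by rw [inv_div]]
      exact inv_anti₀ (by linarith) h.1) with hN
  have hNa : ∀ ρ θ, N ρ θ = (k + ε * K (curveOf z ρ θ))⁻¹ := fun ρ θ => rfl
  have hmaps : Set.MapsTo N s s := fun ρ hρ =>
    isAdmissible_inv_curvature hk hK hB hεB (continuous_curveOf z ρ.continuous)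
      (curveOf_periodic z hk hρ)
  have hcontr : ContractingWith (1 / 2) (hmaps.restrict N s s) := by
    refine ⟨by rw [← NNReal.coe_lt_coe]; norm_num, LipschitzWith.of_dist_le_mul ?_⟩
    rintro ⟨ρ, hρ⟩ ⟨ρ', hρ'⟩
    simp only [Subtype.dist_eq, Set.MapsTo.val_restrict_apply]
    rw [BoundedContinuousFunction.dist_le (by positivity)]
    intro θ
    rw [hNa, hNa, Real.dist_eq]
    refine (abs_inv_curvature_sub_le hk hB hℓ hεB _ _).trans ?_
    have h1 := norm_curveOf_sub_le z z hk hρ hρ' (d := dist ρ ρ') (fun θ => by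
      rw [← Real.dist_eq]; exact BoundedContinuousFunction.dist_coe_le_dist θ) θ
    rw [sub_self, norm_zero, zero_add] at h1
    calc _ ≤ |ε| * (4 / k ^ 2 * ℓ) * (160 * dist ρ ρ') := by gcongr
      _ = (|ε| * (4 / k ^ 2 * ℓ) * 160) * dist ρ ρ' := by ring
      _ ≤ (1 / 2) * dist ρ ρ' := by gcongr
      _ = _ := by norm_num
  obtain ⟨ρ, hρ, hfix, -⟩ := hcontr.exists_fixedPoint' hclosed.isComplete hmaps
    (x := BoundedContinuousFunction.const ℝ (1 / k)) (isAdmissible_const hk) (edist_ne_top _ _)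
  exact ⟨ρ, hρ, fun θ => (DFunLike.congr_fun hfix θ).symm⟩

end FixedPoint

/-- A family of closed curves `γ z`, with velocities `σ z` and mean values `z`, that solve the
equation of prescribed curvature `k + ε K` up to the constant vector `c z`, and that stay close
to the circles of radius `1 / k`. -/
structure IsPerturbedCircles (K : ℝ × ℝ → ℝ) (k ε C : ℝ) (γ σ : ℝ × ℝ → ℝ → ℝ × ℝ)
    (c : ℝ × ℝ → ℝ × ℝ) : Prop where
  hasDerivAt : ∀ z θ, HasDerivAt (γ z) (σ z θ) θ
  continuous_velocity : ∀ z, Continuous (σ z)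
  periodic : ∀ z, Function.Periodic (γ z) (2 * π)
  equation : ∀ z θ, (k + ε * K (γ z θ)) • σ z θ = (cos θ, sin θ) - c z
  mean_fst : ∀ z, ∫ θ in (0:ℝ)..(2 * π), (γ z θ).1 = 2 * π * z.1
  mean_snd : ∀ z, ∫ θ in (0:ℝ)..(2 * π), (γ z θ).2 = 2 * π * z.2
  lipschitz : ∀ z z' θ, ‖γ z θ - γ z' θ‖ ≤ C * ‖z - z'‖
  lipschitz_velocity : ∀ z z' θ, ‖σ z θ - σ z' θ‖ ≤ C * ‖z - z'‖
  lipschitz_multiplier : ∀ z z', ‖c z - c z'‖ ≤ C * ‖z - z'‖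
  near : ∀ z θ, ‖γ z θ - (z.1 + sin θ / k, z.2 - cos θ / k)‖ ≤ C * |ε|
  near_velocity : ∀ z θ, ‖σ z θ - (cos θ / k, sin θ / k)‖ ≤ C * |ε|

lemma exists_isPerturbedCircles {K : ℝ × ℝ → ℝ} {B ℓ k ε : ℝ} (hk : 0 < k) (hK : Continuous K)
    (hB : ∀ p, |K p| ≤ B)
    (hℓ : ∀ p q, |K p - K q| ≤ ℓ * ‖p - q‖) (hℓ0 : 0 ≤ ℓ) (hεB : |ε| * B ≤ k / 2)
    (hεℓ : |ε| * (4 / k ^ 2 * ℓ) * 160 ≤ 1 / 2) :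
    ∃ γ σ c, IsPerturbedCircles K k ε (161 + 4 * k + 640 * B / k ^ 2) γ σ c := by
  choose ρ hρ hfix using exists_radius hk hK hB hℓ hℓ0 hεB hεℓ
  have hB0 : 0 ≤ B := (abs_nonneg _).trans (hB 0)
  have hC0 : 0 ≤ 640 * B / k ^ 2 := by positivity
  have hdist : ∀ z z' θ, |ρ z θ - ρ z' θ| ≤ ‖z - z'‖ := by
    intro z z' θ
    have hle : dist (ρ z) (ρ z') ≤
        |ε| * (4 / k ^ 2 * ℓ) * (‖z - z'‖ + 160 * dist (ρ z) (ρ z')) := by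
      rw [BoundedContinuousFunction.dist_le (by positivity)]
      intro θ
      rw [hfix z, hfix z', Real.dist_eq]
      refine (abs_inv_curvature_sub_le hk hB hℓ hεB _ _).trans ?_
      gcongr
      exact norm_curveOf_sub_le z z' hk (hρ z) (hρ z') (fun θ => by
        rw [← Real.dist_eq]; exact BoundedContinuousFunction.dist_coe_le_dist θ) θ
    rw [← Real.dist_eq]
    refine (BoundedContinuousFunction.dist_coe_le_dist θ).trans ?_
    have h0 : 0 ≤ dist (ρ z) (ρ z') := dist_nonneg
    nlinarith [mul_le_mul_of_nonneg_right hεℓ h0,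
      mul_le_mul_of_nonneg_right hεℓ (norm_nonneg (z - z')), norm_nonneg (z - z')]
  have hcirc : ∀ z θ, |ρ z θ - 1 / k| ≤ 4 / k ^ 2 * (|ε| * B) := by
    intro z θ
    rw [hfix z, one_div]
    refine (abs_inv_sub_inv_le hk (curvature_bounds hB hεB _).1 (by linarith)).trans ?_
    rw [add_sub_cancel_left, abs_mul]
    gcongr
    exact hB _
  have cspeed : ∀ z τ, IsDirection τ → Continuous (centeredSpeed (ρ z) τ) := fun z τ hτ =>
    continuous_centeredSpeed (hρ z).cont hτ
  have hmean : ∀ z τ, IsDirection τ → ∀ a : ℝ,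
      ∫ θ in (0:ℝ)..(2 * π), (a + meanZeroPrim (centeredSpeed (ρ z) τ) θ) = 2 * π * a := by
    intro z τ hτ a
    rw [intervalIntegral.integral_add intervalIntegrable_const
      ((continuous_meanZeroPrim (cspeed z τ hτ)).intervalIntegrable _ _),
      integral_meanZeroPrim (cspeed z τ hτ), intervalIntegral.integral_const, smul_eq_mul,
      sub_zero, add_zero]
  refine ⟨fun z => curveOf z (ρ z),
    fun z θ => (centeredSpeed (ρ z) cos θ, centeredSpeed (ρ z) sin θ),
    fun z => (weightedMean (ρ z) cos, weightedMean (ρ z) sin), ?_⟩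
  constructor
  · intro z θ
    exact ((hasDerivAt_meanZeroPrim (cspeed z _ isDirection_cos) θ).const_add _).prodMk
      ((hasDerivAt_meanZeroPrim (cspeed z _ isDirection_sin) θ).const_add _)
  · exact fun z => (cspeed z _ isDirection_cos).prodMk (cspeed z _ isDirection_sin)
  · exact fun z => curveOf_periodic z hk (hρ z)
  · intro z θ
    have h1 : (k + ε * K (curveOf z (ρ z) θ)) * ρ z θ = 1 := by
      rw [hfix z θ]
      exact mul_inv_cancel₀ (by linarith [(curvature_bounds hB hεB (curveOf z (ρ z) θ)).1] :
        0 < k + ε * K (curveOf z (ρ z) θ)).ne'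
    ext
    · simp only [centeredSpeed, Prod.smul_mk, smul_eq_mul, Prod.mk_sub_mk]
      linear_combination (cos θ - weightedMean (ρ z) cos) * h1
    · simp only [centeredSpeed, Prod.smul_mk, smul_eq_mul, Prod.mk_sub_mk]
      linear_combination (sin θ - weightedMean (ρ z) sin) * h1
  · exact fun z => hmean z cos isDirection_cos z.1
  · exact fun z => hmean z sin isDirection_sin z.2
  · intro z z' θ
    refine (norm_curveOf_sub_le z z' hk (hρ z) (hρ z') (hdist z z') θ).trans ?_
    nlinarith [norm_nonneg (z - z'), mul_nonneg hk.le (norm_nonneg (z - z')),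
      mul_nonneg hC0 (norm_nonneg (z - z'))]
  · intro z z' θ
    have h : ∀ τ, IsDirection τ → |centeredSpeed (ρ z) τ θ - centeredSpeed (ρ z') τ θ| ≤
        (161 + 4 * k + 640 * B / k ^ 2) * ‖z - z'‖ := fun τ hτ => by
      refine (abs_centeredSpeed_sub_le hk (hρ z) (hρ z') hτ (hdist z z') θ).trans ?_
      gcongr
      linarith
    exact max_le (h cos isDirection_cos) (h sin isDirection_sin)
  · intro z z'
    have h : ∀ τ, IsDirection τ → |weightedMean (ρ z) τ - weightedMean (ρ z') τ| ≤
        (161 + 4 * k + 640 * B / k ^ 2) * ‖z - z'‖ := fun τ hτ => by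
      refine (abs_weightedMean_sub_le hk (hρ z) (hρ z') hτ (hdist z z')).trans ?_
      gcongr
      linarith
    exact max_le (h cos isDirection_cos) (h sin isDirection_sin)
  · intro z θ
    rw [← curveOf_const]
    refine (norm_curveOf_sub_le z z hk (hρ z) (isAdmissible_const hk) (hcirc z) θ).trans ?_
    rw [sub_self, norm_zero]
    calc _ = 640 * B / k ^ 2 * |ε| := by ring
      _ ≤ _ := by gcongr; linarith
  · intro z θ
    have h : ∀ τ, IsDirection τ →
        |centeredSpeed (ρ z) τ θ - centeredSpeed (fun _ => 1 / k) τ θ| ≤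
        (161 + 4 * k + 640 * B / k ^ 2) * |ε| := fun τ hτ => by
      refine (abs_centeredSpeed_sub_le hk (hρ z) (isAdmissible_const hk) hτ (hcirc z) θ).trans ?_
      calc _ = 40 * B / k ^ 2 * |ε| := by ring
        _ ≤ 640 * B / k ^ 2 * |ε| := by gcongr; norm_num
        _ ≤ _ := by gcongr; linarith
    have h1 := h cos isDirection_cos
    have h2 := h sin isDirection_sin
    rw [centeredSpeed_const_cos] at h1
    rw [centeredSpeed_const_sin] at h2
    exact max_le h1 h2

namespace IsPerturbedCircles

variable {K : ℝ × ℝ → ℝ} {k ε C : ℝ} {γ σ : ℝ × ℝ → ℝ → ℝ × ℝ} {c : ℝ × ℝ → ℝ × ℝ}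

lemma continuous_curve (h : IsPerturbedCircles K k ε C γ σ c) (z : ℝ × ℝ) : Continuous (γ z) :=
  continuous_iff_continuousAt.2 fun θ => (h.hasDerivAt z θ).continuousAt

/-- The action `∫ (T × γ + Q(γ) γ₂')`, where `Q` is a primitive in the first variable of the
prescribed curvature, has gradient `2π c ×` along the family. -/
lemma hasFDerivAt_action (h : IsPerturbedCircles K k ε C γ σ c) (hC : 0 ≤ C) {Q : ℝ × ℝ → ℝ}
    (hQ : ContDiff ℝ 1 Q) (hQK : ∀ p, fderiv ℝ Q p (1, 0) = k + ε * K p) (z : ℝ × ℝ) :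
    HasFDerivAt (fun z => ∫ θ in (0:ℝ)..(2 * π),
        (cos θ * (γ z θ).2 - sin θ * (γ z θ).1 + Q (γ z θ) * (σ z θ).2))
      ((2 * π) • ((c z).1 • ContinuousLinearMap.snd ℝ ℝ ℝ
        - (c z).2 • ContinuousLinearMap.fst ℝ ℝ ℝ)) z := by
  have h2π : (0 : ℝ) < 2 * π := by positivity
  have hQc : Continuous Q := hQ.continuous
  have hdQ : Continuous (fderiv ℝ Q) := hQ.continuous_fderiv one_ne_zero
  have hγc := h.continuous_curve
  have hσc := h.continuous_velocity
  obtain ⟨R, hR⟩ := isCompact_Icc.exists_bound_of_continuousOn (s := Set.Icc 0 (2 * π))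
    (hγc z).continuousOn
  obtain ⟨S, hS⟩ := isCompact_Icc.exists_bound_of_continuousOn (s := Set.Icc 0 (2 * π))
    (hσc z).continuousOn
  obtain ⟨D, hD⟩ := isCompact_Icc.exists_bound_of_continuousOn (s := Set.Icc 0 (2 * π))
    (hdQ.comp (hγc z)).continuousOn
  have hS0 : 0 ≤ S := (norm_nonneg _).trans (hS 0 ⟨le_rfl, h2π.le⟩)
  have hD0 : 0 ≤ D := (norm_nonneg _).trans (hD 0 ⟨le_rfl, h2π.le⟩)
  have hlin : ∀ p u : ℝ × ℝ, fderiv ℝ Q p u =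
      (k + ε * K p) * u.1 + fderiv ℝ Q p (0, 1) * u.2 := by
    intro p u
    have : u = u.1 • ((1 : ℝ), (0 : ℝ)) + u.2 • ((0 : ℝ), (1 : ℝ)) := by ext <;> simp
    conv_lhs => rw [this]
    rw [map_add, map_smul, map_smul, hQK, smul_eq_mul, smul_eq_mul]
    ring
  have hident : ∀ v : ℝ × ℝ,
      (∫ θ in (0:ℝ)..(2 * π), (cos θ * (γ (z + v) θ).2 - sin θ * (γ (z + v) θ).1
          + Q (γ (z + v) θ) * (σ (z + v) θ).2))
        - (∫ θ in (0:ℝ)..(2 * π),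
          (cos θ * (γ z θ).2 - sin θ * (γ z θ).1 + Q (γ z θ) * (σ z θ).2))
        - 2 * π * ((c z).1 * v.2 - (c z).2 * v.1)
      = ∫ θ in (0:ℝ)..(2 * π),
          ((Q (γ (z + v) θ) - Q (γ z θ)) * (σ (z + v) θ - σ z θ).2
          + (Q (γ (z + v) θ) - Q (γ z θ) - fderiv ℝ Q (γ z θ) (γ (z + v) θ - γ z θ))
            * (σ z θ).2) := by
    intro v
    have c1 := hγc z
    have c2 := hγc (z + v)
    have c3 := hσc z
    have c4 := hσc (z + v)
    have c5 : Continuous fun θ => fderiv ℝ Q (γ z θ) (σ z θ) := (hdQ.comp c1).clm_apply c3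
    have e3 : ∫ θ in (0:ℝ)..(2 * π), ((c z).1 * ((γ (z + v) θ).2 - (γ z θ).2)
        - (c z).2 * ((γ (z + v) θ).1 - (γ z θ).1))
        = 2 * π * ((c z).1 * v.2 - (c z).2 * v.1) := by
      have i1 : ∀ w, IntervalIntegrable (fun θ => (γ w θ).1) volume 0 (2 * π) := fun w =>
        (continuous_fst.comp (hγc w)).intervalIntegrable _ _
      have i2 : ∀ w, IntervalIntegrable (fun θ => (γ w θ).2) volume 0 (2 * π) := fun w =>
        (continuous_snd.comp (hγc w)).intervalIntegrable _ _
      rw [intervalIntegral.integral_sub (((i2 _).sub (i2 _)).const_mul _)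
        (((i1 _).sub (i1 _)).const_mul _), intervalIntegral.integral_const_mul,
        intervalIntegral.integral_const_mul, intervalIntegral.integral_sub (i2 _) (i2 _),
        intervalIntegral.integral_sub (i1 _) (i1 _), h.mean_fst, h.mean_fst, h.mean_snd,
        h.mean_snd, Prod.fst_add, Prod.snd_add]
      ring
    have e4 : ∫ θ in (0:ℝ)..(2 * π),
        (fderiv ℝ Q (γ z θ) (σ z θ) * ((γ (z + v) θ).2 - (γ z θ).2)
          + Q (γ z θ) * ((σ (z + v) θ).2 - (σ z θ).2)) = 0 := by
      have hd : ∀ θ, HasDerivAt (fun θ => Q (γ z θ) * ((γ (z + v) θ).2 - (γ z θ).2))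
          (fderiv ℝ Q (γ z θ) (σ z θ) * ((γ (z + v) θ).2 - (γ z θ).2)
          + Q (γ z θ) * ((σ (z + v) θ).2 - (σ z θ).2)) θ := fun θ =>
        (((hQ.differentiable one_ne_zero) _).hasFDerivAt.comp_hasDerivAt θ
          (h.hasDerivAt z θ)).mul
          ((h.hasDerivAt (z + v) θ).snd_comp.sub (h.hasDerivAt z θ).snd_comp)
      rw [intervalIntegral.integral_eq_sub_of_hasDerivAt (fun θ _ => hd θ)
        ((by fun_prop : Continuous _).intervalIntegrable _ _)]
      have p1 := h.periodic z 0
      have p2 := h.periodic (z + v) 0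
      rw [zero_add] at p1 p2
      simp only [p1, p2, sub_self]
    rw [← e3]
    refine ((sub_zero _).symm.trans (congrArg (HSub.hSub _) e4.symm)).trans ?_
    rw [← intervalIntegral.integral_sub, ← intervalIntegral.integral_sub,
      ← intervalIntegral.integral_sub]
    · refine intervalIntegral.integral_congr fun θ _ => ?_
      have q1 := congrArg Prod.fst (h.equation z θ)
      have q2 := congrArg Prod.snd (h.equation z θ)
      simp only [Prod.smul_fst, Prod.smul_snd, smul_eq_mul, Prod.fst_sub, Prod.snd_sub] at q1 q2
      have l1 := hlin (γ z θ) (σ z θ)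
      have l2 := hlin (γ z θ) (γ (z + v) θ - γ z θ)
      simp only [Prod.fst_sub, Prod.snd_sub] at l2 ⊢
      rw [l1, l2]
      linear_combination (-((γ (z + v) θ).2 - (γ z θ).2)) * q1
        + ((γ (z + v) θ).1 - (γ z θ).1) * q2
    all_goals exact (by fun_prop : Continuous _).intervalIntegrable _ _
  rw [hasFDerivAt_iff_isLittleO_nhds_zero, Asymptotics.isLittleO_iff]
  intro η hη
  set η' : ℝ := min 1 (η / (4 * π * (C * S + 1))) with hη'
  have hη'0 : 0 < η' := by positivity
  have hη'S : η' * (C * S) * (4 * π) ≤ η := by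
    have : η' ≤ η / (4 * π * (C * S + 1)) := min_le_right _ _
    rw [le_div_iff₀ (by positivity)] at this
    nlinarith [mul_pos hη'0 Real.pi_pos]
  obtain ⟨δ, hδ, hT⟩ := exists_uniform_taylor hQ R hη'0
  have hm : 0 < min (δ / (C + 1)) (η / (4 * π * ((D + 1) * C * C + 1))) := by positivity
  filter_upwards [Metric.ball_mem_nhds (0 : ℝ × ℝ) hm] with v hv
  rw [mem_ball_zero_iff, lt_min_iff, lt_div_iff₀ (by positivity),
    lt_div_iff₀ (by positivity)] at hv
  have hvn := norm_nonneg v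
  have hL : ((2 * π) • ((c z).1 • ContinuousLinearMap.snd ℝ ℝ ℝ
        - (c z).2 • ContinuousLinearMap.fst ℝ ℝ ℝ)) v
      = 2 * π * ((c z).1 * v.2 - (c z).2 * v.1) := by simp
  rw [hL, hident v]
  have hbound : ∀ θ ∈ Set.uIoc 0 (2 * π),
      ‖(Q (γ (z + v) θ) - Q (γ z θ)) * (σ (z + v) θ - σ z θ).2
          + (Q (γ (z + v) θ) - Q (γ z θ) - fderiv ℝ Q (γ z θ) (γ (z + v) θ - γ z θ))
            * (σ z θ).2‖ ≤ ((D + 1) * C * C * ‖v‖ + η' * (C * S)) * ‖v‖ := by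
    intro θ hθ
    rw [Set.uIoc_of_le h2π.le] at hθ
    have hθ' : θ ∈ Set.Icc 0 (2 * π) := ⟨hθ.1.le, hθ.2⟩
    have l1 := h.lipschitz (z + v) z θ
    have l2 := (norm_snd_le _).trans (h.lipschitz_velocity (z + v) z θ)
    rw [add_sub_cancel_left] at l1 l2
    have l3 := (norm_snd_le _).trans (hS θ hθ')
    have t1 := hT (γ z θ) (mem_closedBall_zero_iff.2 (hR θ hθ')) (γ (z + v) θ - γ z θ)
      (by nlinarith)
    rw [add_sub_cancel, ← Real.norm_eq_abs] at t1
    have t2 : ‖Q (γ (z + v) θ) - Q (γ z θ)‖ ≤ (D + 1) * (C * ‖v‖) := by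
      have t3 : ‖fderiv ℝ Q (γ z θ) (γ (z + v) θ - γ z θ)‖ ≤ D * ‖γ (z + v) θ - γ z θ‖ :=
        ContinuousLinearMap.le_of_opNorm_le _ (hD θ hθ') _
      calc _ = ‖(Q (γ (z + v) θ) - Q (γ z θ) - fderiv ℝ Q (γ z θ) (γ (z + v) θ - γ z θ))
            + fderiv ℝ Q (γ z θ) (γ (z + v) θ - γ z θ)‖ := by rw [sub_add_cancel]
        _ ≤ η' * ‖γ (z + v) θ - γ z θ‖ + D * ‖γ (z + v) θ - γ z θ‖ :=
          (norm_add_le _ _).trans (add_le_add t1 t3)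
        _ = (D + η') * ‖γ (z + v) θ - γ z θ‖ := by ring
        _ ≤ _ := by gcongr; exact min_le_left _ _
    refine (norm_add_le _ _).trans ?_
    rw [norm_mul, norm_mul]
    calc _ ≤ ((D + 1) * (C * ‖v‖)) * (C * ‖v‖) + (η' * (C * ‖v‖)) * S := by
          gcongr
          exact t1.trans (by gcongr)
      _ = _ := by ring
  refine (intervalIntegral.norm_integral_le_of_norm_le_const hbound).trans ?_
  rw [sub_zero, abs_of_pos h2π]
  have hv2 : (D + 1) * C * C * ‖v‖ * (4 * π) ≤ η := by nlinarith [mul_nonneg hvn Real.pi_pos.le]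
  nlinarith

end IsPerturbedCircles

lemma integral_trig_form (a b x y : ℝ) :
    ∫ θ in (0:ℝ)..(2 * π), (a * sin θ - b * cos θ) * (cos θ * y - sin θ * x)
      = -π * (a * x + b * y) := by
  have hd : ∀ θ, HasDerivAt (fun θ => (a * y + b * x) * (sin θ * sin θ) / 2
      - a * x * (θ - sin θ * cos θ) / 2 - b * y * (θ + sin θ * cos θ) / 2)
      ((a * sin θ - b * cos θ) * (cos θ * y - sin θ * x)) θ := by
    intro θ
    have hs := hasDerivAt_sin θ
    have hc := hasDerivAt_cos θ
    have hi := hasDerivAt_id θ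
    refine ((((hs.mul hs).const_mul (a * y + b * x)).div_const 2).sub
      (((hi.sub (hs.mul hc)).const_mul (a * x)).div_const 2) |>.sub
      (((hi.add (hs.mul hc)).const_mul (b * y)).div_const 2)).congr_deriv ?_
    linear_combination (a * x / 2 + b * y / 2) * (Real.sin_sq_add_cos_sq θ)
  rw [intervalIntegral.integral_eq_sub_of_hasDerivAt (fun θ _ => hd θ)
    ((by fun_prop : Continuous _).intervalIntegrable _ _)]
  simp only [sin_two_pi, sin_zero]
  ring

lemma abs_cross_le (u v : ℝ × ℝ) : |u.1 * v.2 - u.2 * v.1| ≤ 2 * ‖u‖ * ‖v‖ := by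
  have h1 : |u.1| ≤ ‖u‖ := norm_fst_le u
  have h2 : |u.2| ≤ ‖u‖ := norm_snd_le u
  have h3 : |v.1| ≤ ‖v‖ := norm_fst_le v
  have h4 : |v.2| ≤ ‖v‖ := norm_snd_le v
  calc _ ≤ |u.1| * |v.2| + |u.2| * |v.1| := by
        rw [← abs_mul, ← abs_mul]; exact abs_sub _ _
    _ ≤ ‖u‖ * ‖v‖ + ‖u‖ * ‖v‖ := by gcongr
    _ = _ := by ring

namespace IsPerturbedCircles

variable {K : ℝ × ℝ → ℝ} {k ε C : ℝ} {γ σ : ℝ × ℝ → ℝ → ℝ × ℝ} {c : ℝ × ℝ → ℝ × ℝ}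

lemma integral_velocity_fst (h : IsPerturbedCircles K k ε C γ σ c) (z : ℝ × ℝ) :
    ∫ θ in (0:ℝ)..(2 * π), (σ z θ).1 = 0 := by
  rw [intervalIntegral.integral_eq_sub_of_hasDerivAt
    (fun θ _ => (h.hasDerivAt z θ).fst_comp)
    ((continuous_fst.comp (h.continuous_velocity z)).intervalIntegrable _ _)]
  have p := h.periodic z 0
  rw [zero_add] at p
  rw [p, sub_self]

lemma integral_velocity_snd (h : IsPerturbedCircles K k ε C γ σ c) (z : ℝ × ℝ) :
    ∫ θ in (0:ℝ)..(2 * π), (σ z θ).2 = 0 := by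
  rw [intervalIntegral.integral_eq_sub_of_hasDerivAt
    (fun θ _ => (h.hasDerivAt z θ).snd_comp)
    ((continuous_snd.comp (h.continuous_velocity z)).intervalIntegrable _ _)]
  have p := h.periodic z 0
  rw [zero_add] at p
  rw [p, sub_self]

lemma multiplier_cross (h : IsPerturbedCircles K k ε C γ σ c) (hK : Continuous K) (z v : ℝ × ℝ) :
    2 * π * ((c z).1 * v.2 - (c z).2 * v.1) = -ε * ∫ θ in (0:ℝ)..(2 * π),
      (K (γ z θ) - K z) * ((σ z θ).1 * v.2 - (σ z θ).2 * v.1) := by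
  have c1 := h.continuous_curve z
  have c2 := h.continuous_velocity z
  have e0 : ∀ θ, (c z).1 * v.2 - (c z).2 * v.1 + ε * ((K (γ z θ) - K z)
        * ((σ z θ).1 * v.2 - (σ z θ).2 * v.1))
      = v.2 * cos θ - v.1 * sin θ - ((k + ε * K z) * v.2 * (σ z θ).1
        - (k + ε * K z) * v.1 * (σ z θ).2) := by
    intro θ
    have q1 := congrArg Prod.fst (h.equation z θ)
    have q2 := congrArg Prod.snd (h.equation z θ)
    simp only [Prod.smul_fst, Prod.smul_snd, smul_eq_mul, Prod.fst_sub, Prod.snd_sub] at q1 q2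
    linear_combination v.2 * q1 - v.1 * q2
  have e1 : ∫ θ in (0:ℝ)..(2 * π), ((c z).1 * v.2 - (c z).2 * v.1 + ε * ((K (γ z θ) - K z)
        * ((σ z θ).1 * v.2 - (σ z θ).2 * v.1))) = 0 := by
    simp only [e0]
    rw [intervalIntegral.integral_sub, intervalIntegral.integral_sub,
      intervalIntegral.integral_sub, intervalIntegral.integral_const_mul,
      intervalIntegral.integral_const_mul, intervalIntegral.integral_const_mul,
      intervalIntegral.integral_const_mul, h.integral_velocity_fst, h.integral_velocity_snd]
    · simp
    all_goals exact (by fun_prop : Continuous _).intervalIntegrable _ _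
  rw [intervalIntegral.integral_add intervalIntegrable_const
    ((by fun_prop : Continuous _).intervalIntegrable _ _), intervalIntegral.integral_const,
    intervalIntegral.integral_const_mul, smul_eq_mul] at e1
  linarith

lemma norm_curve_sub_sub_le (h : IsPerturbedCircles K k ε C γ σ c) (z : ℝ × ℝ) (θ : ℝ) :
    ‖γ z θ - z - (sin θ / k, -cos θ / k)‖ ≤ C * |ε| := by
  have := h.near z θ
  rwa [show ((z.1 + sin θ / k, z.2 - cos θ / k) : ℝ × ℝ) = z + (sin θ / k, -cos θ / k) by
    ext <;> simp; ring, ← sub_sub] at this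

lemma norm_curve_sub_le (h : IsPerturbedCircles K k ε C γ σ c) (hk : 0 < k)
    (hC : C * |ε| ≤ 1 / k) (z : ℝ × ℝ) (θ : ℝ) : ‖γ z θ - z‖ ≤ 2 / k := by
  have b1 := h.norm_curve_sub_sub_le z θ
  have bn : ‖((sin θ / k, -cos θ / k) : ℝ × ℝ)‖ ≤ 1 / k := by
    refine max_le ?_ ?_ <;> rw [norm_div, Real.norm_of_nonneg hk.le] <;> gcongr
    · exact abs_sin_le_one θ
    · rw [norm_neg]; exact abs_cos_le_one θ
  have := norm_le_norm_add_norm_sub' (γ z θ - z) (sin θ / k, -cos θ / k)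
  have hkk : 2 / k = 1 / k + 1 / k := by ring
  linarith

/-- The multiplier `c z` is close to `(ε / 2k²) (∂₂K, -∂₁K)(z)`. -/
lemma abs_multiplier_cross_sub_le (h : IsPerturbedCircles K k ε C γ σ c) (hK : Continuous K)
    (hk : 0 < k) (hC : C * |ε| ≤ 1 / k) {η N : ℝ} {z : ℝ × ℝ}
    (hN : ‖fderiv ℝ K z‖ ≤ N)
    (hη : ∀ w : ℝ × ℝ, ‖w‖ ≤ 2 / k → |K (z + w) - K z - fderiv ℝ K z w| ≤ η * ‖w‖)
    (hη0 : 0 ≤ η) (v : ℝ × ℝ) :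
    |2 * k ^ 2 * ((c z).1 * v.2 - (c z).2 * v.1) - ε * fderiv ℝ K z v| ≤
      |ε| * (16 * η + 12 * N * (C * |ε|) * k) * ‖v‖ := by
  have h2π : (0 : ℝ) < 2 * π := by positivity
  have hN0 : 0 ≤ N := (norm_nonneg _).trans hN
  have hC0 : 0 ≤ C * |ε| := (norm_nonneg _).trans (h.near z 0)
  have c1 := h.continuous_curve z
  have c2 := h.continuous_velocity z
  set Λ := fderiv ℝ K z with hΛ
  have hlin : ∀ x y : ℝ, Λ (x, y) = Λ (1, 0) * x + Λ (0, 1) * y := by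
    intro x y
    have : ((x, y) : ℝ × ℝ) = x • ((1 : ℝ), (0 : ℝ)) + y • ((0 : ℝ), (1 : ℝ)) := by ext <;> simp
    rw [this, map_add, map_smul, map_smul, smul_eq_mul, smul_eq_mul]
    ring
  have hmain : Λ v = -(k ^ 2 / π) * ∫ θ in (0:ℝ)..(2 * π),
      Λ (sin θ / k, -cos θ / k) * (cos θ / k * v.2 - sin θ / k * v.1) := by
    have e : ∀ θ, Λ (sin θ / k, -cos θ / k) * (cos θ / k * v.2 - sin θ / k * v.1) =
        (k ^ 2)⁻¹ * ((Λ (1, 0) * sin θ - Λ (0, 1) * cos θ) * (cos θ * v.2 - sin θ * v.1)) := by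
      intro θ
      rw [hlin]
      field_simp
      ring
    simp only [e]
    rw [intervalIntegral.integral_const_mul, integral_trig_form,
      show Λ v = Λ (v.1, v.2) from rfl, hlin]
    field_simp
  have hΛc : Continuous fun θ : ℝ => Λ (sin θ / k, -cos θ / k) := Λ.continuous.comp (by fun_prop)
  have hdiff : 2 * k ^ 2 * ((c z).1 * v.2 - (c z).2 * v.1) - ε * Λ v =
      -ε * (k ^ 2 / π) * ∫ θ in (0:ℝ)..(2 * π),
        ((K (γ z θ) - K z) * ((σ z θ).1 * v.2 - (σ z θ).2 * v.1)
        - Λ (sin θ / k, -cos θ / k) * (cos θ / k * v.2 - sin θ / k * v.1)) := by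
    rw [intervalIntegral.integral_sub, mul_sub, hmain]
    · have := h.multiplier_cross hK z v
      have hπ : π ≠ 0 := Real.pi_ne_zero
      have e : k ^ 2 / π * (2 * π) = 2 * k ^ 2 := by field_simp
      linear_combination (k ^ 2 / π) * this - ((c z).1 * v.2 - (c z).2 * v.1) * e
    all_goals exact (by fun_prop : Continuous _).intervalIntegrable _ _
  have hbound : ∀ θ, |(K (γ z θ) - K z) * ((σ z θ).1 * v.2 - (σ z θ).2 * v.1)
        - Λ (sin θ / k, -cos θ / k) * (cos θ / k * v.2 - sin θ / k * v.1)| ≤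
        (8 * η / k ^ 2 + 6 * N * (C * |ε|) / k) * ‖v‖ := by
    intro θ
    set n : ℝ × ℝ := (sin θ / k, -cos θ / k) with hn
    set T : ℝ × ℝ := (cos θ / k, sin θ / k) with hT
    have bT : ‖T‖ ≤ 1 / k := by
      refine max_le ?_ ?_ <;> rw [norm_div, Real.norm_of_nonneg hk.le] <;> gcongr
      · exact abs_cos_le_one θ
      · exact abs_sin_le_one θ
    have b1 : ‖γ z θ - z - n‖ ≤ C * |ε| := h.norm_curve_sub_sub_le z θ
    have b2 : ‖σ z θ - T‖ ≤ C * |ε| := h.near_velocity z θ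
    have hkk : 2 / k = 1 / k + 1 / k := by ring
    have b3 : ‖γ z θ - z‖ ≤ 2 / k := h.norm_curve_sub_le hk hC z θ
    have b4 : ‖σ z θ‖ ≤ 2 / k := by
      have := norm_le_norm_add_norm_sub' (σ z θ) T
      linarith
    have t1 := hη _ b3
    rw [add_sub_cancel] at t1
    have t2 : |Λ (γ z θ - z - n)| ≤ N * (C * |ε|) :=
      (Λ.le_of_opNorm_le hN _).trans (by gcongr)
    have bn : ‖n‖ ≤ 1 / k := by
      refine max_le ?_ ?_ <;> rw [norm_div, Real.norm_of_nonneg hk.le] <;> gcongr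
      · exact abs_sin_le_one θ
      · rw [norm_neg]; exact abs_cos_le_one θ
    have t3 : |Λ n| ≤ N * (1 / k) := (Λ.le_of_opNorm_le hN _).trans (by gcongr)
    have x1 := abs_cross_le (σ z θ) v
    have x2 := abs_cross_le (σ z θ - T) v
    have x1' : |(σ z θ).1 * v.2 - (σ z θ).2 * v.1| ≤ 2 * (2 / k) * ‖v‖ := x1.trans (by gcongr)
    have x2' : |(σ z θ - T).1 * v.2 - (σ z θ - T).2 * v.1| ≤ 2 * (C * |ε|) * ‖v‖ :=
      x2.trans (by gcongr)
    have hsplit : (K (γ z θ) - K z) * ((σ z θ).1 * v.2 - (σ z θ).2 * v.1)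
        - Λ n * (cos θ / k * v.2 - sin θ / k * v.1)
        = (K (γ z θ) - K z - Λ (γ z θ - z)) * ((σ z θ).1 * v.2 - (σ z θ).2 * v.1)
          + Λ (γ z θ - z - n) * ((σ z θ).1 * v.2 - (σ z θ).2 * v.1)
          + Λ n * ((σ z θ - T).1 * v.2 - (σ z θ - T).2 * v.1) := by
      rw [map_sub Λ (γ z θ - z) n]
      simp only [hT, Prod.fst_sub, Prod.snd_sub]
      ring
    rw [hsplit]
    calc _ ≤ (η * (2 / k)) * (2 * (2 / k) * ‖v‖) + (N * (C * |ε|)) * (2 * (2 / k) * ‖v‖)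
          + (N * (1 / k)) * (2 * (C * |ε|) * ‖v‖) := by
          refine (abs_add_le _ _).trans (add_le_add ((abs_add_le _ _).trans (add_le_add ?_ ?_)) ?_)
          · rw [abs_mul]
            exact mul_le_mul (t1.trans (by gcongr)) x1' (abs_nonneg _) (by positivity)
          · rw [abs_mul]
            exact mul_le_mul t2 x1' (abs_nonneg _) (by positivity)
          · rw [abs_mul]
            exact mul_le_mul t3 x2' (abs_nonneg _) (by positivity)
      _ = _ := by ring
  rw [hdiff, abs_mul, abs_mul, abs_neg, abs_of_pos (by positivity : 0 < k ^ 2 / π)]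
  calc _ ≤ |ε| * (k ^ 2 / π) *
        ((8 * η / k ^ 2 + 6 * N * (C * |ε|) / k) * ‖v‖ * |2 * π - 0|) := by
        gcongr
        exact abs_integral_le_of_abs_le hbound
    _ = _ := by
        rw [sub_zero, abs_of_pos h2π]
        field_simp
        ring

lemma multiplier_eq_zero_of_eq_zero (h : IsPerturbedCircles K k 0 C γ σ c) (hK : Continuous K)
    (z : ℝ × ℝ) : c z = 0 := by
  have h1 := h.multiplier_cross hK z (0, 1)
  have h2 := h.multiplier_cross hK z (1, 0)
  have hπ := Real.pi_ne_zero
  simp [hπ] at h1 h2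
  exact Prod.ext h1 h2

/-- The rescaled action is a `C¹` function close to `K`, whose critical points are zeros of the
multiplier. -/
lemma exists_reduced_function (h : IsPerturbedCircles K k ε C γ σ c) (hC0 : 0 ≤ C)
    (hK : ContDiff ℝ 1 K) (hk : 0 < k) (hε : ε ≠ 0) (hC : C * |ε| ≤ 1 / k) {N η R : ℝ}
    (hN : ∀ p, ‖fderiv ℝ K p‖ ≤ N) (hη0 : 0 ≤ η) (hR : 0 ≤ R)
    (hη : ∀ z ∈ Metric.closedBall (0 : ℝ × ℝ) R, ∀ w : ℝ × ℝ, ‖w‖ ≤ 2 / k →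
      |K (z + w) - K z - fderiv ℝ K z w| ≤ η * ‖w‖) :
    ∃ g : ℝ × ℝ → ℝ, ContDiff ℝ 1 g ∧
      (∀ z ∈ Metric.closedBall (0 : ℝ × ℝ) R, |g z - K z| + ‖fderiv ℝ g z - fderiv ℝ K z‖ ≤
        (16 * η + 12 * N * (C * |ε|) * k) * (R + 1)) ∧
      ∀ z, fderiv ℝ g z = 0 → c z = 0 := by
  have hN0 : 0 ≤ N := (norm_nonneg _).trans (hN 0)
  have hs0 : 0 ≤ 16 * η + 12 * N * (C * |ε|) * k := by positivity
  have hKd : ∀ z, DifferentiableAt ℝ K z := fun z => hK.differentiable one_ne_zero z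
  obtain ⟨Q, hQ, hQK⟩ : ∃ Q : ℝ × ℝ → ℝ, ContDiff ℝ 1 Q ∧
      ∀ p, fderiv ℝ Q p (1, 0) = k + ε * K p := by
    refine exists_primitive_fst (M := |ε| * N) (by fun_prop) fun p => ?_
    rw [fderiv_const_add, fderiv_const_mul (hKd p), norm_smul, Real.norm_eq_abs]
    exact mul_le_mul_of_nonneg_left (hN p) (abs_nonneg ε)
  set a : ℝ × ℝ → ℝ := fun z => ∫ θ in (0:ℝ)..(2 * π),
    (cos θ * (γ z θ).2 - sin θ * (γ z θ).1 + Q (γ z θ) * (σ z θ).2) with ha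
  set g : ℝ × ℝ → ℝ := fun z => k ^ 2 / (π * ε) * a z + (K 0 - k ^ 2 / (π * ε) * a 0) with hg
  set g' : ℝ × ℝ → (ℝ × ℝ →L[ℝ] ℝ) := fun z => (2 * k ^ 2 / ε) •
    ((c z).1 • ContinuousLinearMap.snd ℝ ℝ ℝ - (c z).2 • ContinuousLinearMap.fst ℝ ℝ ℝ) with hg'
  have hd : ∀ z, HasFDerivAt g (g' z) z := by
    intro z
    refine (((h.hasFDerivAt_action hC0 hQ hQK z).const_mul (k ^ 2 / (π * ε))).add_const
      _).congr_fderiv ?_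
    rw [smul_smul]
    congr 1
    field_simp
  have hfd : ∀ z, fderiv ℝ g z = g' z := fun z => (hd z).fderiv
  have hg'v : ∀ z v, g' z v = 2 * k ^ 2 / ε * ((c z).1 * v.2 - (c z).2 * v.1) := fun z v => by
    simp [hg']
  have hc : Continuous c := by
    refine (LipschitzWith.of_dist_le_mul (K := ⟨C, hC0⟩) fun z z' => ?_).continuous
    rw [dist_eq_norm, dist_eq_norm]
    exact h.lipschitz_multiplier z z'
  have hclose : ∀ z ∈ Metric.closedBall (0 : ℝ × ℝ) R, ‖g' z - fderiv ℝ K z‖ ≤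
      16 * η + 12 * N * (C * |ε|) * k := by
    intro z hz
    refine ContinuousLinearMap.opNorm_le_bound _ hs0 fun v => ?_
    have := h.abs_multiplier_cross_sub_le hK.continuous hk hC (hN z) (hη z hz) hη0 v
    have e : (g' z - fderiv ℝ K z) v =
        ε⁻¹ * (2 * k ^ 2 * ((c z).1 * v.2 - (c z).2 * v.1) - ε * fderiv ℝ K z v) := by
      rw [sub_apply, hg'v]
      field_simp
    rw [e, norm_mul, norm_inv, Real.norm_eq_abs, Real.norm_eq_abs,
      inv_mul_le_iff₀ (abs_pos.2 hε), ← mul_assoc]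
    exact this
  refine ⟨g, contDiff_one_iff_hasFDerivAt.2 ⟨g', by fun_prop, hd⟩, fun z hz => ?_, fun z hz => ?_⟩
  · have hmv := (convex_closedBall (0 : ℝ × ℝ) R).norm_image_sub_le_of_norm_hasFDerivWithin_le
      (f := fun z => g z - K z)
      (fun x _ => ((hd x).sub (hKd x).hasFDerivAt).hasFDerivWithinAt) hclose
      (Metric.mem_closedBall_self hR) hz
    have hz' : ‖z‖ ≤ R := by simpa using hz
    have e0 : g 0 - K 0 = 0 := by simp [hg]
    rw [e0, sub_zero, sub_zero, Real.norm_eq_abs] at hmv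
    have := mul_le_mul_of_nonneg_left hz' hs0
    have := hclose z hz
    rw [hfd]
    linarith
  · rw [hfd] at hz
    have h1 := congrArg (fun f => f (0, 1)) hz
    have h2 := congrArg (fun f => f (1, 0)) hz
    simp only [hg'v] at h1 h2
    simp [hε, hk.ne'] at h1 h2
    exact Prod.ext h1 h2

end IsPerturbedCircles

lemma ContDiff.exists_bounds_of_hasCompactSupport {K : ℝ × ℝ → ℝ} (hK : ContDiff ℝ 1 K)
    (hs : HasCompactSupport K) : ∃ B N : ℝ, (∀ p, |K p| ≤ B) ∧ (∀ p, ‖fderiv ℝ K p‖ ≤ N) ∧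
      ∀ p q, |K p - K q| ≤ N * ‖p - q‖ := by
  obtain ⟨B, hB⟩ := hs.exists_bound_of_continuous hK.continuous
  obtain ⟨N, hN⟩ := (hs.fderiv ℝ).exists_bound_of_continuous (hK.continuous_fderiv one_ne_zero)
  refine ⟨B, N, hB, hN, fun p q => ?_⟩
  exact convex_univ.norm_image_sub_le_of_norm_fderiv_le
    (fun x _ => hK.differentiable one_ne_zero x) (fun x _ => hN x) (Set.mem_univ q)
    (Set.mem_univ p)

/-- Lyapunov-Schmidt reduction for compactly supported perturbations. -/
lemma exists_perturbed_circles_and_reduced_function {K : ℝ × ℝ → ℝ} (hK : ContDiff ℝ 1 K)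
    (hs : HasCompactSupport K) {R r : ℝ} (hR : 0 ≤ R) (hr : 0 < r) :
    ∃ k₀ ≥ (1 : ℝ), ∀ k > k₀, ∃ ε₀ > (0 : ℝ), ∀ ε : ℝ, |ε| < ε₀ →
      (∀ p, 0 < k + ε * K p) ∧ ∃ C γ σ c, IsPerturbedCircles K k ε C γ σ c ∧ C * |ε| ≤ 1 / k ∧
        (ε ≠ 0 → ∃ g : ℝ × ℝ → ℝ, ContDiff ℝ 1 g ∧
          (∀ z ∈ Metric.closedBall (0 : ℝ × ℝ) R,
            |g z - K z| + ‖fderiv ℝ g z - fderiv ℝ K z‖ < r) ∧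
          ∀ z, fderiv ℝ g z = 0 → c z = 0) := by
  obtain ⟨B, N, hB, hN, hℓ⟩ := hK.exists_bounds_of_hasCompactSupport hs
  have hB0 : 0 ≤ B := (abs_nonneg _).trans (hB 0)
  have hN0 : 0 ≤ N := (norm_nonneg _).trans (hN 0)
  set s := r / (R + 2) with hs_def
  have hs0 : 0 < s := by positivity
  have hsr : s * (R + 1) < r := by
    rw [hs_def, div_mul_eq_mul_div, div_lt_iff₀ (by positivity)]
    nlinarith
  obtain ⟨δ, hδ, hT⟩ := exists_uniform_taylor hK R (show 0 < s / 32 by positivity)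
  refine ⟨max 1 (2 / δ), le_max_left _ _, fun k hk => ?_⟩
  have hk1 : 1 < k := (le_max_left _ _).trans_lt hk
  have hk0 : 0 < k := by linarith
  have hkδ : 2 / k ≤ δ := by
    have := (le_max_right _ _).trans_lt hk
    rw [div_lt_iff₀ hδ] at this
    rw [div_le_iff₀ hk0]
    linarith
  set C := 161 + 4 * k + 640 * B / k ^ 2 with hC
  have hC0 : 0 ≤ C := by positivity
  have hsmall : ∀ a b : ℝ, 0 < b → ∀ᶠ ε : ℝ in 𝓝 0, a * |ε| < b := by
    intro a b hb
    have : Continuous fun ε : ℝ => a * |ε| := by fun_prop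
    refine this.continuousAt.eventually_lt_const ?_
    simpa using hb
  obtain ⟨ε₀, hε₀, hball⟩ := Metric.eventually_nhds_iff.1
    ((hsmall B (k / 2) (by positivity)).and ((hsmall (4 / k ^ 2 * N * 160) (1 / 2) (by norm_num)).and
      ((hsmall C (1 / k) (by positivity)).and
        (hsmall (12 * N * C * k) (s / 2) (by positivity)))))
  refine ⟨ε₀, hε₀, fun ε hε => ?_⟩
  obtain ⟨b1, b2, b3, b4⟩ := hball (show dist ε 0 < ε₀ by simpa using hε)
  have hεB : |ε| * B ≤ k / 2 := by linarith
  refine ⟨fun p => by linarith [(curvature_bounds hB hεB p).1], ?_⟩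
  obtain ⟨γ, σ, c, h⟩ := exists_isPerturbedCircles hk0 hK.continuous hB hℓ hN0 hεB (by linarith)
  refine ⟨C, γ, σ, c, h, b3.le, fun hne => ?_⟩
  obtain ⟨g, hg, hclose, hcrit⟩ := h.exists_reduced_function hC0 hK hk0 hne b3.le hN
    (show 0 ≤ s / 32 by positivity) hR fun z hz w hw => hT z hz w (hw.trans hkδ)
  refine ⟨g, hg, fun z hz => (hclose z hz).trans_lt (lt_of_le_of_lt ?_ hsr), hcrit⟩
  gcongr
  linarith

/-- if `K` has a stable critical point in a bounded open set `A ⊂ ℝ²`, then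
for every sufficiently large `k` and every `ε` close enough to `0` there exists an
embedded Euclidean `(k+εK)`-loop. -/
theorem stmt_18 (K : (ℝ × ℝ) → ℝ) (hK : ContDiff ℝ 1 K)
    (A : Set (ℝ × ℝ)) (hAo : IsOpen A) (hAb : Bornology.IsBounded A)
    (hstab : HasStableCriticalPt K A) :
    ∃ k₀ > (0:ℝ), ∀ k > k₀, ∃ ε₀ > (0:ℝ), ∀ ε : ℝ, |ε| < ε₀ →
      ∃ u : ℝ → ℝ × ℝ, IsELoop (fun z => k + ε * K z) u ∧ IsEmbedded u := by
  obtain ⟨r, hr, hstab⟩ := hstab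
  obtain ⟨R, hR, hAR⟩ := hAb.subset_closedBall_lt 0 (0 : ℝ × ℝ)
  have hclA : closure A ⊆ Metric.closedBall 0 R := closure_minimal hAR Metric.isClosed_closedBall
  let χ : ContDiffBump (0 : ℝ × ℝ) := ⟨R + 3, R + 4, by linarith, by linarith⟩
  set J : ℝ × ℝ → ℝ := fun p => χ p * K p with hJ
  have hJK : Set.EqOn J K (Metric.closedBall 0 (R + 3)) := fun p hp => by
    simp [hJ, χ.one_of_mem_closedBall hp]
  have hJc : ContDiff ℝ 1 J := χ.contDiff.mul hK
  have hJs : HasCompactSupport J := χ.hasCompactSupport.mul_right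
  have hfd : ∀ z ∈ Metric.closedBall (0 : ℝ × ℝ) R, fderiv ℝ J z = fderiv ℝ K z := by
    intro z hz
    refine Filter.EventuallyEq.fderiv_eq (hJK.eventuallyEq_of_mem ?_)
    refine Metric.closedBall_mem_nhds_of_mem ?_
    rw [Metric.mem_ball]
    rw [Metric.mem_closedBall] at hz
    linarith
  obtain ⟨k₀, hk₀, hmain⟩ := exists_perturbed_circles_and_reduced_function hJc hJs hR.le hr
  refine ⟨k₀, by linarith, fun k hk => ?_⟩
  obtain ⟨ε₀, hε₀, hmain⟩ := hmain k hk
  refine ⟨ε₀, hε₀, fun ε hε => ?_⟩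
  obtain ⟨hpos, C, γ, σ, c, h, hC, hred⟩ := hmain ε hε
  have hk1 : 1 < k := by linarith
  have hk0 : 0 < k := by linarith
  obtain ⟨z, hz, hcz⟩ : ∃ z ∈ Metric.closedBall (0 : ℝ × ℝ) R, c z = 0 := by
    rcases eq_or_ne ε 0 with rfl | hne
    · exact ⟨0, Metric.mem_closedBall_self hR.le,
        h.multiplier_eq_zero_of_eq_zero hJc.continuous 0⟩
    · obtain ⟨g, hg, hclose, hcrit⟩ := hred hne
      obtain ⟨z, hz, hz0⟩ := hstab g ⟨Set.univ, isOpen_univ, Set.subset_univ _, hg.contDiffOn⟩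
        fun z hz => by
          have := hclose z (hclA hz)
          rwa [hfd z (hclA hz), hJK (Metric.closedBall_subset_closedBall (by linarith)
            (hclA hz))] at this
      exact ⟨z, hAR hz, hcrit z hz0⟩
  have hγK : ∀ θ, J (γ z θ) = K (γ z θ) := by
    intro θ
    refine hJK ?_
    have h1 := h.norm_curve_sub_le hk0 hC z θ
    have h2 : 2 / k ≤ 2 := div_le_self (by norm_num) hk1.le
    have h3 := norm_le_norm_add_norm_sub' (γ z θ) z
    rw [mem_closedBall_zero_iff] at hz ⊢
    linarith
  have hposK : ∀ θ, 0 < k + ε * K (γ z θ) := fun θ => hγK θ ▸ hpos (γ z θ)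
  refine exists_loop_of_tangent (κ := fun p => k + ε * K p) (γ := γ z)
    (by have := hK.continuous; fun_prop) hposK (fun θ => ?_) (h.periodic z)
  refine (h.hasDerivAt z θ).congr_deriv ?_
  have he := h.equation z θ
  rw [hcz, sub_zero, hγK] at he
  rw [← he, smul_smul, inv_mul_cancel₀ (hposK θ).ne', one_smul]
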